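/- arXiv:1703.03627 — 3 statements merged into one kernel-verified Lean document; each statement's English description precedes it below -/
import Mathlib

section
/- Let r ≥ 2 and let 𝔩_0, …, 𝔩_r be positive integers; set b̄ = lcm(𝔩_0, …, 𝔩_r), b_i = b̄/𝔩_i and b(i) = gcd{ b_j : j ≠ i }. Then the identity Σ_{i=0}^r b(i)/𝔩_i = (r − 1) + 2·b̄/(𝔩_0·𝔩_1⋯𝔩_r) holds in the rational numbers if and only if one of the following holds: (i) gcd(𝔩_u, 𝔩_v) = 1 for all 0 ≤ u < v ≤ r; (ii) there exist 0 ≤ i < j ≤ r with gcd(𝔩_i, 𝔩_j) > 1 and gcd(𝔩_u, 𝔩_v) = 1 for every other pair u < v; (iii) there exist 0 ≤ i < j < k ≤ r with gcd(𝔩_i, 𝔩_j) = gcd(𝔩_i, 𝔩_k) = gcd(𝔩_j, 𝔩_k) = 2 and gcd(𝔩_u, 𝔩_v) = 1 for every pair u < v not contained in {i, j, k}. -/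
/-- `b̄ = lcm(𝔩_0, …, 𝔩_{n-1})`. -/
def bbar {n : ℕ} (l : Fin n → ℕ) : ℕ := Finset.univ.lcm l

/-- `b(i) = gcd{ b_j : j ≠ i }` where `b_j = b̄ / 𝔩_j`. -/
def bOmit {n : ℕ} (l : Fin n → ℕ) (i : Fin n) : ℕ :=
  (Finset.univ.erase i).gcd fun j => bbar l / l j

/-- The gcd of the complementary divisors `B / l j` is the complementary divisor of the lcm. -/
theorem Finset.gcd_div_eq_div_lcm {ι : Type*} {s : Finset ι} (hs : s.Nonempty) {l : ι → ℕ}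
    {B : ℕ} (hl : ∀ j ∈ s, l j ∣ B) :
    (s.gcd fun j => B / l j) = B / s.lcm l := by
  have hL : s.lcm l ∣ B := Finset.lcm_dvd hl
  apply Nat.dvd_antisymm
  · obtain ⟨j₀, hj₀⟩ := hs
    set d := s.gcd fun j => B / l j
    have hdj : ∀ j ∈ s, d ∣ B / l j := fun j hj => Finset.gcd_dvd hj
    have hdB : d ∣ B := (hdj j₀ hj₀).trans (Nat.div_dvd_of_dvd (hl j₀ hj₀))
    rw [Nat.dvd_div_iff_mul_dvd hL, mul_comm, ← Nat.dvd_div_iff_mul_dvd hdB]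
    refine Finset.lcm_dvd fun j hj => ?_
    rw [Nat.dvd_div_iff_mul_dvd hdB, mul_comm, ← Nat.dvd_div_iff_mul_dvd (hl j hj)]
    exact hdj j hj
  · refine Finset.dvd_gcd fun j hj => ?_
    exact Nat.div_dvd_div_left hL (Finset.dvd_lcm hj)

/-- Members coprime to `a` may be dropped from an lcm when taking the gcd with `a`. -/
theorem Nat.gcd_finset_lcm_eq_of_subset {ι : Type*} [DecidableEq ι] {s t : Finset ι} {l : ι → ℕ}
    {a : ℕ} (hst : s ⊆ t) (h : ∀ u ∈ t \ s, a.Coprime (l u)) :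
    a.gcd (t.lcm l) = a.gcd (s.lcm l) := by
  apply Nat.dvd_antisymm
  · have hc : a.Coprime (∏ u ∈ t \ s, l u) := Nat.Coprime.prod_right h
    have hdvd : t.lcm l ∣ s.lcm l * ∏ u ∈ t \ s, l u := by
      refine Finset.lcm_dvd fun u hu => ?_
      by_cases hus : u ∈ s
      · exact (Finset.dvd_lcm hus).mul_right _
      · exact (Finset.dvd_prod_of_mem l (Finset.mem_sdiff.2 ⟨hu, hus⟩)).mul_left _
    refine (Nat.gcd_dvd_gcd_of_dvd_right a hdvd).trans ?_
    rw [Nat.Coprime.gcd_mul_right_cancel_right _ hc.symm]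
  · exact Nat.gcd_dvd_gcd_of_dvd_right a (Finset.lcm_mono hst)

theorem Finset.lcm_univ_eq_lcm_mul_prod_compl {ι : Type*} [Fintype ι] [DecidableEq ι]
    {l : ι → ℕ} {T : Finset ι}
    (h : ∀ u v, u ≠ v → ¬(u ∈ T ∧ v ∈ T) → (l u).Coprime (l v)) :
    Finset.univ.lcm l = T.lcm l * ∏ u ∈ Tᶜ, l u := by
  have hprod : Tᶜ.lcm l = ∏ u ∈ Tᶜ, l u := by
    refine Finset.lcm_eq_prod fun u hu v _ huv => h u v huv fun hT => ?_
    exact Finset.mem_compl.1 hu hT.1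
  have hcop : (T.lcm l).Coprime (∏ u ∈ Tᶜ, l u) := by
    refine Nat.Coprime.prod_right fun u hu => ?_
    refine Nat.Coprime.coprime_dvd_left
      (Finset.lcm_dvd fun v hv => Finset.dvd_prod_of_mem l hv : T.lcm l ∣ ∏ v ∈ T, l v) ?_
    refine Nat.Coprime.prod_left fun v hv => h v u ?_ fun hT => Finset.mem_compl.1 hu hT.2
    rintro rfl
    exact Finset.mem_compl.1 hu hv
  rw [← Finset.union_compl T, Finset.lcm_union, hprod, lcm_eq_nat_lcm, hcop.lcm_eq_mul]

/-- The part `gcd(l i, lcm (l j : j ≠ i))` of `l i` shared with the other members. -/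
def sharedPart {ι : Type*} [Fintype ι] [DecidableEq ι] (l : ι → ℕ) (i : ι) : ℕ :=
  (l i).gcd ((Finset.univ.erase i).lcm l)

theorem coprime_of_sharedPart_eq_one {ι : Type*} [Fintype ι] [DecidableEq ι] {l : ι → ℕ} {i j : ι}
    (h : sharedPart l i = 1) (hij : i ≠ j) : (l i).Coprime (l j) :=
  Nat.Coprime.coprime_dvd_right (Finset.dvd_lcm (Finset.mem_erase.2 ⟨hij.symm, Finset.mem_univ j⟩)) h

theorem finset_lcm_pos {ι : Type*} {l : ι → ℕ} (hl : ∀ i, 0 < l i) (s : Finset ι) :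
    0 < s.lcm l :=
  Nat.pos_of_ne_zero fun h => by
    obtain ⟨i, -, hi⟩ := Finset.lcm_eq_zero_iff.1 h
    exact (hl i).ne' hi

theorem bOmit_div_eq_inv_sharedPart {n : ℕ} (hn : 2 ≤ n) {l : Fin n → ℕ} (hl : ∀ i, 0 < l i)
    (i : Fin n) : (bOmit l i : ℚ) / l i = (sharedPart l i : ℚ)⁻¹ := by
  have hne : (Finset.univ.erase i).Nonempty := by
    rw [← Finset.card_pos, Finset.card_erase_of_mem (Finset.mem_univ i)]
    simp
    omega
  set L := (Finset.univ.erase i).lcm l with hLdef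
  have hL : 0 < L := finset_lcm_pos hl _
  have hbbar : bbar l = (l i).lcm L := by
    rw [bbar, ← Finset.insert_erase (Finset.mem_univ i), Finset.lcm_insert, lcm_eq_nat_lcm]
  have hb : bOmit l i = bbar l / L :=
    Finset.gcd_div_eq_div_lcm hne fun j _ => Finset.dvd_lcm (Finset.mem_univ j)
  have hbL : bOmit l i * L = bbar l := by
    rw [hb, hbbar]
    exact Nat.div_mul_cancel (Nat.dvd_lcm_right (l i) L)
  have hmul : bOmit l i * sharedPart l i = l i := by
    refine Nat.eq_of_mul_eq_mul_right hL ?_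
    rw [mul_right_comm, hbL, hbbar, mul_comm, sharedPart, ← hLdef, Nat.gcd_mul_lcm]
  have hs : 0 < sharedPart l i := Nat.gcd_pos_of_pos_left _ (hl i)
  have hb0 : 0 < bOmit l i := Nat.pos_of_ne_zero fun h => by
    rw [h, zero_mul] at hmul
    exact (hl i).ne hmul
  rw [← hmul]
  push_cast
  field_simp

theorem Nat.gcd_mul_gcd_mul_gcd_mul_lcm {a b c : ℕ} (ha : 0 < a) (hb : 0 < b) (hc : 0 < c) :
    b.gcd c * a.gcd c * a.gcd b * a.lcm (b.lcm c) = a * b * c * (b.gcd c).gcd (a.gcd c) := by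
  have h1 := Nat.gcd_pos_of_pos_left c hb
  have h2 := Nat.gcd_pos_of_pos_left c ha
  have h3 := Nat.gcd_pos_of_pos_left b ha
  have h4 := Nat.lcm_pos hb hc
  have h5 := Nat.lcm_pos ha h4
  have h6 := Nat.gcd_pos_of_pos_left (a.gcd c) h1
  refine Nat.eq_of_factorization_eq (by positivity) (by positivity) fun p => ?_
  simp only [Nat.factorization_mul, Nat.factorization_gcd, Nat.factorization_lcm, ne_eq, ha.ne',
    hb.ne', hc.ne', h1.ne', h2.ne', h3.ne', h4.ne', h5.ne', h6.ne', not_false_eq_true,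
    mul_eq_zero, or_self, Finsupp.add_apply, Finsupp.inf_apply, Finsupp.sup_apply]
  omega

theorem one_or_one_of_add_eq_mul_add_two {x y z : ℕ} (hx : 0 < x) (hy : 0 < y) (hz : 0 < z)
    (h : x + y + z = x * y * z + 2) :
    x = 1 ∧ y = 1 ∨ x = 1 ∧ z = 1 ∨ y = 1 ∧ z = 1 := by
  obtain ⟨x, rfl⟩ := Nat.exists_eq_add_of_lt hx
  obtain ⟨y, rfl⟩ := Nat.exists_eq_add_of_lt hy
  obtain ⟨z, rfl⟩ := Nat.exists_eq_add_of_lt hz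
  have h0 : x * y * z + x * y + x * z + y * z = 0 := by linarith
  have hxy : x * y = 0 := by omega
  have hxz : x * z = 0 := by omega
  have hyz : y * z = 0 := by omega
  rw [mul_eq_zero] at hxy hxz hyz
  omega

/-- The solutions of `x + y + z = P + 2` where `P · gcd(x, y) = x y z` and `gcd(x, y) ∣ z`. -/
theorem add_eq_add_two_iff {x y z P : ℕ} (hx : 0 < x) (hy : 0 < y) (hz : 0 < z)
    (hdz : x.gcd y ∣ z) (hP : P * x.gcd y = x * y * z) :
    x + y + z = P + 2 ↔
      (x = 1 ∧ y = 1 ∨ x = 1 ∧ z = 1 ∨ y = 1 ∧ z = 1) ∨ x = 2 ∧ y = 2 ∧ z = 2 := by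
  constructor
  · intro h
    obtain ⟨x', hx'⟩ := Nat.gcd_dvd_left x y
    obtain ⟨y', hy'⟩ := Nat.gcd_dvd_right x y
    obtain ⟨z', hz'⟩ := hdz
    have hd : 0 < x.gcd y := Nat.gcd_pos_of_pos_left _ hx
    generalize x.gcd y = d at *
    subst hx' hy' hz'
    have hP' : P = d * (d * (x' * y' * z')) := Nat.eq_of_mul_eq_mul_right hd (by rw [hP]; ring)
    have hd2 : d ∣ 2 := by
      rw [← Nat.dvd_add_right (Dvd.intro _ hP'.symm), ← h]
      exact Dvd.intro (x' + y' + z') (by ring)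
    rcases (Nat.dvd_prime Nat.prime_two).1 hd2 with rfl | rfl
    · left
      simp only [one_mul] at *
      exact one_or_one_of_add_eq_mul_add_two hx hy hz (by rw [h, hP'])
    · right
      obtain ⟨x, rfl⟩ := Nat.exists_eq_add_of_lt (Nat.pos_of_mul_pos_left hx)
      obtain ⟨y, rfl⟩ := Nat.exists_eq_add_of_lt (Nat.pos_of_mul_pos_left hy)
      obtain ⟨z, rfl⟩ := Nat.exists_eq_add_of_lt (Nat.pos_of_mul_pos_left hz)
      have h0 : x + y + z + 2 * (x * y * z + x * y + x * z + y * z) = 0 := by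
        rw [hP'] at h
        linarith
      omega
  · rintro ((⟨rfl, rfl⟩ | ⟨rfl, rfl⟩ | ⟨rfl, rfl⟩) | ⟨rfl, rfl, rfl⟩) <;> simp at hP <;> omega

/-- The genus zero identity for a triple `a, b, c`. -/
theorem inv_gcd_lcm_sum_eq_iff {a b c : ℕ} (ha : 0 < a) (hb : 0 < b) (hc : 0 < c) :
    ((a.gcd (b.lcm c) : ℚ)⁻¹ + (b.gcd (a.lcm c) : ℚ)⁻¹ + (c.gcd (a.lcm b) : ℚ)⁻¹
        = 1 + 2 * ((a.lcm (b.lcm c) : ℚ) / (a * b * c))) ↔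
      (b.gcd c = 1 ∧ a.gcd c = 1 ∨ b.gcd c = 1 ∧ a.gcd b = 1 ∨ a.gcd c = 1 ∧ a.gcd b = 1) ∨
        b.gcd c = 2 ∧ a.gcd c = 2 ∧ a.gcd b = 2 := by
  have hx := Nat.gcd_pos_of_pos_left c hb
  have hy := Nat.gcd_pos_of_pos_left c ha
  have hz := Nat.gcd_pos_of_pos_left b ha
  have hM : 0 < a.lcm (b.lcm c) := Nat.lcm_pos ha (Nat.lcm_pos hb hc)
  have hga := Nat.gcd_pos_of_pos_left (b.lcm c) ha
  have hgb := Nat.gcd_pos_of_pos_left (a.lcm c) hb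
  have hgc := Nat.gcd_pos_of_pos_left (a.lcm b) hc
  have key : ∀ u v w : ℕ, v.gcd w * u.gcd (v.lcm w) * u.lcm (v.lcm w) = u * v * w := by
    intro u v w
    rw [mul_assoc, Nat.gcd_mul_lcm, mul_left_comm, Nat.gcd_mul_lcm, mul_assoc]
  have ka := key a b c
  have kb := key b a c
  have kc := key c a b
  rw [← Nat.lcm_assoc, Nat.lcm_comm b a, Nat.lcm_assoc] at kb
  rw [Nat.lcm_comm c, Nat.lcm_assoc] at kc
  set P := b.gcd c * a.gcd (b.lcm c) with hPdef
  have kP : P * (b.gcd c).gcd (a.gcd c) = b.gcd c * a.gcd c * a.gcd b := by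
    refine Nat.eq_of_mul_eq_mul_right hM ?_
    rw [Nat.gcd_mul_gcd_mul_gcd_mul_lcm ha hb hc, ← ka]
    ring
  have hPb : P = a.gcd c * b.gcd (a.lcm c) :=
    Nat.eq_of_mul_eq_mul_right hM (by rw [ka, kb]; ring)
  have hPc : P = a.gcd b * c.gcd (a.lcm b) :=
    Nat.eq_of_mul_eq_mul_right hM (by rw [ka, kc]; ring)
  have hP0 : 0 < P := Nat.mul_pos hx hga
  have inv_eq : ∀ x g : ℕ, 0 < g → P = x * g → (g : ℚ)⁻¹ = x / P := by
    intro x g hg h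
    have hx0 : x ≠ 0 := by
      rintro rfl
      omega
    rw [h]
    push_cast
    field_simp
  have hlcm : (a.lcm (b.lcm c) : ℚ) / (a * b * c) = 1 / P := by
    have : (P : ℚ) * a.lcm (b.lcm c) = a * b * c := mod_cast ka
    rw [← this]
    field_simp
  have hdz : (b.gcd c).gcd (a.gcd c) ∣ a.gcd b :=
    Nat.dvd_gcd ((Nat.gcd_dvd_right _ _).trans (Nat.gcd_dvd_left _ _))
      ((Nat.gcd_dvd_left _ _).trans (Nat.gcd_dvd_left _ _))
  rw [← add_eq_add_two_iff hx hy hz hdz kP, inv_eq _ _ hga hPdef, inv_eq _ _ hgb hPb,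
    inv_eq _ _ hgc hPc, hlcm, ← @Nat.cast_inj ℚ]
  push_cast
  field_simp

theorem sum_bOmit_div_eq_iff_of_coprime_outside_triple {r : ℕ} (hr : 2 ≤ r) {l : Fin (r + 1) → ℕ}
    (hl : ∀ i, 0 < l i) {i j k : Fin (r + 1)} (hij : i ≠ j) (hik : i ≠ k) (hjk : j ≠ k)
    (h : ∀ u v, u ≠ v →
      ¬(u ∈ ({i, j, k} : Finset (Fin (r + 1))) ∧ v ∈ ({i, j, k} : Finset (Fin (r + 1)))) →
      (l u).Coprime (l v)) :
    (∑ i, (bOmit l i : ℚ) / (l i : ℚ)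
        = (r : ℚ) - 1 + 2 * (bbar l : ℚ) / ∏ i, (l i : ℚ)) ↔
      ((l j).gcd (l k) = 1 ∧ (l i).gcd (l k) = 1 ∨ (l j).gcd (l k) = 1 ∧ (l i).gcd (l j) = 1 ∨
        (l i).gcd (l k) = 1 ∧ (l i).gcd (l j) = 1) ∨
      (l j).gcd (l k) = 2 ∧ (l i).gcd (l k) = 2 ∧ (l i).gcd (l j) = 2 := by
  rw [← inv_gcd_lcm_sum_eq_iff (hl i) (hl j) (hl k)]
  have hcard : ({i, j, k} : Finset (Fin (r + 1))).card = 3 := Finset.card_eq_three.2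
    ⟨i, j, k, hij, hik, hjk, rfl⟩
  have hprodT : ∏ u ∈ ({i, j, k} : Finset (Fin (r + 1))), (l u : ℚ) = l i * l j * l k := by
    rw [Finset.prod_insert (by simp [hij, hik]), Finset.prod_pair hjk, mul_assoc]
  have hlcmT : ({i, j, k} : Finset (Fin (r + 1))).lcm l = (l i).lcm ((l j).lcm (l k)) := by
    simp [Finset.lcm_insert, lcm_eq_nat_lcm]
  have hin : ∀ u v w, u ≠ v → u ≠ w → ({u, v, w} : Finset (Fin (r + 1))) = {i, j, k} →
      sharedPart l u = (l u).gcd ((l v).lcm (l w)) := by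
    intro u v w huv huw hT
    rw [sharedPart, Nat.gcd_finset_lcm_eq_of_subset (s := {v, w})]
    · simp [Finset.lcm_insert, lcm_eq_nat_lcm]
    · intro t ht
      simp only [Finset.mem_insert, Finset.mem_singleton] at ht
      rcases ht with rfl | rfl
      · simp [huv.symm]
      · simp [huw.symm]
    · intro t ht
      simp only [Finset.mem_sdiff, Finset.mem_erase, Finset.mem_univ, and_true,
        Finset.mem_insert, Finset.mem_singleton] at ht
      refine h u t (Ne.symm ht.1) fun hm => ?_
      rw [← hT] at hm
      simp only [Finset.mem_insert, Finset.mem_singleton] at hm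
      tauto
  have hout : ∀ u ∈ ({i, j, k} : Finset (Fin (r + 1)))ᶜ, (sharedPart l u : ℚ)⁻¹ = 1 := by
    intro u hu
    rw [sharedPart, Nat.gcd_finset_lcm_eq_of_subset (Finset.empty_subset _)]
    · simp
    · intro t ht
      simp only [Finset.mem_sdiff, Finset.mem_erase] at ht
      exact h u t (Ne.symm ht.1.1) fun hm => Finset.mem_compl.1 hu hm.1
  have hsum : ∑ u, (bOmit l u : ℚ) / (l u : ℚ) = ((l i).gcd ((l j).lcm (l k)) : ℚ)⁻¹
      + ((l j).gcd ((l i).lcm (l k)) : ℚ)⁻¹ + ((l k).gcd ((l i).lcm (l j)) : ℚ)⁻¹ + (r - 2) := by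
    rw [Finset.sum_congr rfl fun u _ => bOmit_div_eq_inv_sharedPart (by omega) hl u,
      ← Finset.sum_add_sum_compl {i, j, k}, Finset.sum_congr rfl hout, Finset.sum_const,
      Finset.card_compl, hcard, Fintype.card_fin, Finset.sum_insert (by simp [hij, hik]),
      Finset.sum_pair hjk, hin i j k hij hik rfl,
      hin j i k hij.symm hjk (Finset.insert_comm _ _ _),
      hin k i j hik.symm hjk.symm (by ext; simp; tauto),
      nsmul_eq_mul, Nat.cast_sub (by omega)]
    push_cast
    ring
  have hlcm : 2 * (bbar l : ℚ) / ∏ i, (l i : ℚ)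
      = 2 * (((l i).lcm ((l j).lcm (l k)) : ℚ) / (l i * l j * l k)) := by
    have hne : ∏ u ∈ ({i, j, k} : Finset (Fin (r + 1)))ᶜ, (l u : ℚ) ≠ 0 :=
      Finset.prod_ne_zero_iff.2 fun u _ => mod_cast (hl u).ne'
    rw [bbar, Finset.lcm_univ_eq_lcm_mul_prod_compl h, hlcmT,
      ← Finset.prod_mul_prod_compl {i, j, k} fun u => (l u : ℚ), hprodT]
    push_cast
    rw [← mul_assoc, mul_div_mul_right _ _ hne, mul_div_assoc]
  rw [hsum, hlcm]
  constructor <;> intro h <;> linarith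

/-- If the genus zero identity holds, at most three members fail to be coprime to all others. -/
theorem card_sharedPart_ne_one_le_three {r : ℕ} (hr : 1 ≤ r) {l : Fin (r + 1) → ℕ}
    (hl : ∀ i, 0 < l i)
    (h : ∑ i, (bOmit l i : ℚ) / (l i : ℚ)
      = (r : ℚ) - 1 + 2 * (bbar l : ℚ) / ∏ i, (l i : ℚ)) :
    (Finset.univ.filter fun i => sharedPart l i ≠ 1).card ≤ 3 := by
  have hbound : ∀ i, (bOmit l i : ℚ) / l i ≤ 1 - if sharedPart l i ≠ 1 then 1 / 2 else 0 := by
    intro i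
    rw [bOmit_div_eq_inv_sharedPart (by omega) hl]
    split_ifs with hi
    · have h0 : 0 < sharedPart l i := Nat.gcd_pos_of_pos_left _ (hl i)
      have h2 : (2 : ℚ) ≤ sharedPart l i := by
        exact_mod_cast (show 2 ≤ sharedPart l i by omega)
      have := inv_anti₀ (by norm_num) h2
      linarith
    · simp [not_not.1 hi]
  have hsum := Finset.sum_le_sum fun i (_ : i ∈ Finset.univ) => hbound i
  rw [Finset.sum_sub_distrib, ← Finset.sum_filter, Finset.sum_const, Finset.sum_const,
    Finset.card_univ, Fintype.card_fin, h, nsmul_eq_mul, nsmul_eq_mul] at hsum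
  have hpos : 0 < 2 * (bbar l : ℚ) / ∏ i, (l i : ℚ) := by
    have hb : 0 < bbar l := finset_lcm_pos hl _
    have hp : 0 < ∏ i, (l i : ℚ) := Finset.prod_pos fun i _ => mod_cast hl i
    positivity
  push_cast at hsum
  have hlt : ((Finset.univ.filter fun i => sharedPart l i ≠ 1).card : ℚ) < 4 := by linarith
  exact Nat.le_of_lt_succ (mod_cast hlt)

theorem Finset.exists_lt_lt_of_card_eq_three {α : Type*} [LinearOrder α] {s : Finset α}
    (hs : s.card = 3) : ∃ i j k, i < j ∧ j < k ∧ s = {i, j, k} := by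
  refine ⟨s.orderEmbOfFin hs 0, s.orderEmbOfFin hs 1, s.orderEmbOfFin hs 2, by simp, by simp, ?_⟩
  ext x
  rw [← Finset.mem_coe, ← Finset.range_orderEmbOfFin s hs]
  simp only [Set.mem_range, Fin.exists_fin_succ]
  simp [eq_comm]

/-- The identity `Σ b(i)/𝔩_i = (r−1) + 2b̄/(𝔩_0⋯𝔩_r)` (genus zero of the generic
quotient curve) holds if and only if one of the three coprimality constellations
(i), (ii), (iii) of the paper's Corollary 5.5 holds. -/
theorem genus_zero_iff_coprimality_constellation (r : ℕ) (hr : 2 ≤ r)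
    (l : Fin (r + 1) → ℕ) (hl : ∀ i, 0 < l i) :
    (∑ i, (bOmit l i : ℚ) / (l i : ℚ)
        = (r : ℚ) - 1 + 2 * (bbar l : ℚ) / ∏ i, (l i : ℚ)) ↔
      ((∀ u v : Fin (r + 1), u < v → Nat.gcd (l u) (l v) = 1) ∨
       (∃ i j : Fin (r + 1), i < j ∧ 1 < Nat.gcd (l i) (l j) ∧
          ∀ u v : Fin (r + 1), u < v → ¬(u = i ∧ v = j) →
            Nat.gcd (l u) (l v) = 1) ∨
       (∃ i j k : Fin (r + 1), i < j ∧ j < k ∧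
          Nat.gcd (l i) (l j) = 2 ∧ Nat.gcd (l i) (l k) = 2 ∧
          Nat.gcd (l j) (l k) = 2 ∧
          ∀ u v : Fin (r + 1), u < v →
            ¬(u ∈ ({i, j, k} : Set (Fin (r + 1))) ∧
              v ∈ ({i, j, k} : Set (Fin (r + 1)))) →
            Nat.gcd (l u) (l v) = 1)) := by
  constructor
  · intro h
    obtain ⟨T, hT, hcard⟩ := Finset.exists_superset_card_eq
      (card_sharedPart_ne_one_le_three (by omega) hl h) (by simp; omega)
    obtain ⟨i, j, k, hij, hjk, rfl⟩ := Finset.exists_lt_lt_of_card_eq_three hcard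
    have hone : ∀ u, u ∉ ({i, j, k} : Finset (Fin (r + 1))) → sharedPart l u = 1 := by
      intro u hu
      by_contra hne
      exact hu (hT (by simp [hne]))
    have hcop : ∀ u v, u ≠ v →
        ¬(u ∈ ({i, j, k} : Finset (Fin (r + 1))) ∧ v ∈ ({i, j, k} : Finset (Fin (r + 1)))) →
        (l u).Coprime (l v) := by
      intro u v huv hm
      rcases not_and_or.1 hm with hu | hv
      · exact coprime_of_sharedPart_eq_one (hone u hu) huv
      · exact (coprime_of_sharedPart_eq_one (hone v hv) huv.symm).symm
    have hik := hij.trans hjk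
    rw [sum_bOmit_div_eq_iff_of_coprime_outside_triple hr hl hij.ne hik.ne hjk.ne hcop] at h
    have honly : ∀ i' j', i' < j' →
        (∀ u v : Fin (r + 1), u < v → ¬(u = i' ∧ v = j') → (l u).gcd (l v) = 1) →
        (∀ u v : Fin (r + 1), u < v → (l u).gcd (l v) = 1) ∨
          ∃ i j : Fin (r + 1), i < j ∧ 1 < (l i).gcd (l j) ∧
            ∀ u v : Fin (r + 1), u < v → ¬(u = i ∧ v = j) → (l u).gcd (l v) = 1 := by
      intro i' j' hlt hall
      have hpos := Nat.gcd_pos_of_pos_left (l j') (hl i')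
      rcases Nat.lt_or_ge 1 ((l i').gcd (l j')) with h1 | h1
      · exact Or.inr ⟨i', j', hlt, h1, hall⟩
      · left
        intro u v huv
        by_cases he : u = i' ∧ v = j'
        · obtain ⟨rfl, rfl⟩ := he
          omega
        · exact hall u v huv he
    have hpairs : ∀ u v, u < v → (u = i ∧ v = j) ∨ (u = i ∧ v = k) ∨ (u = j ∧ v = k) ∨
        (l u).gcd (l v) = 1 := by
      intro u v huv
      by_cases hm : u ∈ ({i, j, k} : Finset (Fin (r + 1))) ∧
          v ∈ ({i, j, k} : Finset (Fin (r + 1)))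
      · simp only [Finset.mem_insert, Finset.mem_singleton] at hm
        omega
      · exact Or.inr (Or.inr (Or.inr (hcop u v huv.ne hm)))
    rw [← or_assoc]
    rcases h with (⟨h1, h2⟩ | ⟨h1, h2⟩ | ⟨h1, h2⟩) | ⟨h1, h2, h3⟩
    · refine Or.inl (honly i j hij fun u v huv hne => ?_)
      rcases hpairs u v huv with h | ⟨rfl, rfl⟩ | ⟨rfl, rfl⟩ | h <;> tauto
    · refine Or.inl (honly i k hik fun u v huv hne => ?_)
      rcases hpairs u v huv with ⟨rfl, rfl⟩ | h | ⟨rfl, rfl⟩ | h <;> tauto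
    · refine Or.inl (honly j k hjk fun u v huv hne => ?_)
      rcases hpairs u v huv with ⟨rfl, rfl⟩ | ⟨rfl, rfl⟩ | h | h <;> tauto
    · refine Or.inr ⟨i, j, k, hij, hjk, h3, h2, h1, fun u v huv hm => hcop u v huv.ne ?_⟩
      simpa using hm
  · have hsymm : ∀ {p : Fin (r + 1) → Fin (r + 1) → Prop}, (∀ u v, p u v → p v u) →
        (∀ u v, u < v → ¬p u v → (l u).gcd (l v) = 1) →
        ∀ u v, u ≠ v → ¬p u v → (l u).Coprime (l v) := by
      intro p hp hlt u v huv hn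
      rcases lt_or_gt_of_ne huv with h | h
      · exact hlt u v h hn
      · exact Nat.Coprime.symm (hlt v u h fun h' => hn (hp _ _ h'))
    have hpair : ∀ i j : Fin (r + 1), i < j →
        (∀ u v : Fin (r + 1), u < v → ¬(u = i ∧ v = j) → (l u).gcd (l v) = 1) →
        ∑ i, (bOmit l i : ℚ) / (l i : ℚ)
          = (r : ℚ) - 1 + 2 * (bbar l : ℚ) / ∏ i, (l i : ℚ) := by
      intro i j hij h
      have hcop := hsymm (p := fun u v => u = i ∧ v = j ∨ u = j ∧ v = i) (by tauto)
        fun u v huv hn => h u v huv (by tauto)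
      obtain ⟨k, hk⟩ : ∃ k, k ∉ ({i, j} : Finset (Fin (r + 1))) := by
        by_contra! hall
        have := Finset.card_le_card (fun k _ => hall k : Finset.univ ⊆ {i, j})
        have := Finset.card_le_two (a := i) (b := j)
        simp at *
        omega
      simp only [Finset.mem_insert, Finset.mem_singleton, not_or] at hk
      refine (sum_bOmit_div_eq_iff_of_coprime_outside_triple hr hl hij.ne (Ne.symm hk.1)
        (Ne.symm hk.2) fun u v huv hm => hcop u v huv ?_).2 (Or.inl (Or.inl ⟨?_, ?_⟩))
      · simp only [Finset.mem_insert, Finset.mem_singleton] at hm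
        tauto
      · exact hcop j k (Ne.symm hk.2) (by tauto)
      · exact hcop i k (Ne.symm hk.1) (by tauto)
    rintro (h | ⟨i, j, hij, -, h⟩ | ⟨i, j, k, hij, hjk, h1, h2, h3, h⟩)
    · exact hpair 0 (Fin.last r) (by simp [Fin.lt_def]; omega) fun u v huv _ => h u v huv
    · exact hpair i j hij h
    · refine (sum_bOmit_div_eq_iff_of_coprime_outside_triple hr hl hij.ne (hij.trans hjk).ne hjk.ne
        (hsymm (by tauto) fun u v huv hn => h u v huv ?_)).2 (Or.inr ⟨h3, h2, h1⟩)
      simpa using hn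
end

section
/- Let n_0, n_1, n_2 ≥ 1 and let l_i ∈ (ℤ_{>0})^{n_i} for i = 0, 1, 2; put n = n_0 + n_1 + n_2 and write vectors of ℤ^n in three blocks of sizes n_0, n_1, n_2. Let u_1 ∈ ℤ^n have block 0 equal to −l_0, block 1 equal to l_1 and block 2 equal to 0, and let u_2 ∈ ℤ^n have block 0 equal to −l_0, block 1 equal to 0 and block 2 equal to l_2. Set 𝔩_i = gcd of the entries of l_i, 𝔩 = gcd(𝔩_0, 𝔩_1, 𝔩_2) and 𝔩_{ij} = gcd(𝔩_i/𝔩, 𝔩_j/𝔩). Then the torsion subgroup of the abelian group ℤ^n / ⟨u_1, u_2⟩ is isomorphic to (ℤ/𝔩ℤ) × (ℤ/(𝔩·𝔩_{01}·𝔩_{02}·𝔩_{12})ℤ). -/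
/-- A nonzero integer vector is a positive multiple of a vector on which some linear functional
takes the value `1`. -/
theorem exists_eq_smul_dual_apply_eq_one {ι : Type*} (v : ι → ℤ) (hv : v ≠ 0) :
    ∃ (d : ℕ) (w : ι → ℤ) (ψ : (ι → ℤ) →ₗ[ℤ] ℤ), d ≠ 0 ∧ v = (d : ℤ) • w ∧ ψ w = 1 := by
  obtain ⟨e, he⟩ := (IsPrincipalIdealRing.principal
    (LinearMap.range (Module.Dual.eval ℤ (ι → ℤ) v))).principal
  have hdvd (i : ι) : (e.natAbs : ℤ) ∣ v i := by
    have hi : v i ∈ LinearMap.range (Module.Dual.eval ℤ (ι → ℤ) v) :=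
      ⟨LinearMap.proj i, rfl⟩
    rw [he, Submodule.mem_span_singleton] at hi
    obtain ⟨k, hk⟩ := hi
    exact Int.natAbs_dvd.2 ⟨k, by rw [← hk, smul_eq_mul, mul_comm]⟩
  have hmem : (e.natAbs : ℤ) ∈ LinearMap.range (Module.Dual.eval ℤ (ι → ℤ) v) := by
    rw [he, Submodule.mem_span_singleton]
    exact ⟨e.sign, Int.sign_mul_self_eq_natAbs e⟩
  obtain ⟨ψ, hψ⟩ := hmem
  choose w hw using hdvd
  have hvw : v = (e.natAbs : ℤ) • w := funext hw
  have hne : e.natAbs ≠ 0 := by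
    intro h
    exact hv (by rw [hvw, h, Nat.cast_zero, zero_smul])
  refine ⟨e.natAbs, w, ψ, hne, hvw, ?_⟩
  have h : (e.natAbs : ℤ) * ψ w = e.natAbs * 1 := by
    rw [mul_one, ← smul_eq_mul, ← map_smul, ← hvw]
    exact hψ
  exact mul_left_cancel₀ (Nat.cast_ne_zero.2 hne) h

/-- A nonzero vector of natural numbers is its gcd times a vector on which some linear functional
takes the value `1`. -/
theorem exists_eq_gcd_smul_dual_apply_eq_one {ι : Type*} [Fintype ι] (l : ι → ℕ) (hl : l ≠ 0) :
    ∃ (f : ι → ℤ) (ψ : (ι → ℤ) →ₗ[ℤ] ℤ),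
      (fun i => (l i : ℤ)) = ((Finset.univ.gcd l : ℕ) : ℤ) • f ∧ ψ f = 1 := by
  obtain ⟨d, w, ψ, -, hvw, hψ⟩ := exists_eq_smul_dual_apply_eq_one (fun i => (l i : ℤ))
    (fun h => hl (funext fun i => by simpa using congrFun h i))
  have hd : d = Finset.univ.gcd l := by
    apply Nat.dvd_antisymm
    · refine Finset.dvd_gcd fun i _ => Int.natCast_dvd_natCast.1 ⟨w i, ?_⟩
      simpa using congrFun hvw i
    · have h (i : ι) : ((Finset.univ.gcd l : ℕ) : ℤ) ∣ (l i : ℤ) :=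
        Int.natCast_dvd_natCast.2 (Finset.gcd_dvd (Finset.mem_univ i))
      choose k hk using h
      refine Int.natCast_dvd_natCast.1 ⟨ψ k, ?_⟩
      have hvk : (fun i => (l i : ℤ)) = ((Finset.univ.gcd l : ℕ) : ℤ) • k := funext hk
      rw [← smul_eq_mul, ← map_smul, ← hvk, hvw, map_smul, hψ, smul_eq_mul, mul_one]
  exact ⟨w, ψ, hd ▸ hvw, hψ⟩

/-- If `v₁, v₂` is a basis of a direct summand of a torsion-free abelian group `M`, then the
torsion of `M / ⟨a v₁, b v₂⟩` is `ℤ/a × ℤ/b`. -/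
theorem nonempty_torsion_quotient_span_pair_addEquiv {M : Type*} [AddCommGroup M]
    [IsAddTorsionFree M] (v₁ v₂ : M) (A B : M →ₗ[ℤ] ℤ)
    (hA₁ : A v₁ = 1) (hA₂ : A v₂ = 0) (hB₁ : B v₁ = 0) (hB₂ : B v₂ = 1)
    (a b : ℕ) (ha : a ≠ 0) (hb : b ≠ 0) :
    Nonempty (Submodule.torsion ℤ
        (M ⧸ Submodule.span ℤ ({(a : ℤ) • v₁, (b : ℤ) • v₂} : Set M)) ≃+
      (ZMod a × ZMod b)) := by
  set L := Submodule.span ℤ ({(a : ℤ) • v₁, (b : ℤ) • v₂} : Set M) with hL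
  have hmem (s t : ℤ) : s • v₁ + t • v₂ ∈ L ↔ (a : ℤ) ∣ s ∧ (b : ℤ) ∣ t := by
    rw [hL, Submodule.mem_span_pair]
    constructor
    · rintro ⟨x, y, h⟩
      have h₁ := congrArg A h
      have h₂ := congrArg B h
      simp [hA₁, hA₂, hB₁, hB₂] at h₁ h₂
      exact ⟨⟨x, by rw [← h₁, mul_comm]⟩, ⟨y, by rw [← h₂, mul_comm]⟩⟩
    · rintro ⟨⟨x, rfl⟩, ⟨y, rfl⟩⟩
      exact ⟨x, y, by module⟩
  let π : ℤ × ℤ →+ ZMod a × ZMod b :=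
    (Int.castAddHom (ZMod a)).prodMap (Int.castAddHom (ZMod b))
  let ψ : ℤ × ℤ →+ M ⧸ L := L.mkQ.toAddMonoidHom.comp
    (AddMonoidHom.coprod (zmultiplesHom M v₁) (zmultiplesHom M v₂))
  have hψ (p : ℤ × ℤ) : ψ p = L.mkQ (p.1 • v₁ + p.2 • v₂) := rfl
  have hψ_torsion (p : ℤ × ℤ) : ψ p ∈ Submodule.torsion ℤ (M ⧸ L) := by
    rw [Submodule.mem_torsion_iff]
    refine ⟨⟨(a : ℤ) * b, mem_nonZeroDivisors_of_ne_zero (by positivity)⟩, ?_⟩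
    change ((a : ℤ) * b) • ψ p = 0
    rw [hψ, ← map_smul, Submodule.mkQ_apply, Submodule.Quotient.mk_eq_zero, smul_add, smul_smul,
      smul_smul, hmem]
    exact ⟨⟨b * p.1, by ring⟩, ⟨a * p.2, by ring⟩⟩
  let ρ : ℤ × ℤ →+ Submodule.torsion ℤ (M ⧸ L) :=
    ψ.codRestrict (Submodule.torsion ℤ (M ⧸ L)) hψ_torsion
  have hπ_surj : Function.Surjective π :=
    (ZMod.intCast_surjective).prodMap (ZMod.intCast_surjective)
  have hρ_surj : Function.Surjective ρ := by
    rintro ⟨y, hy⟩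
    obtain ⟨x, rfl⟩ := L.mkQ_surjective y
    rw [Submodule.mem_torsion_iff] at hy
    obtain ⟨⟨k, hk⟩, hkx⟩ := hy
    have hk₀ : k ≠ 0 := nonZeroDivisors.ne_zero hk
    change k • L.mkQ x = 0 at hkx
    rw [← map_smul, Submodule.mkQ_apply, Submodule.Quotient.mk_eq_zero, hL,
      Submodule.mem_span_pair] at hkx
    obtain ⟨s, t, h⟩ := hkx
    have h₁ := congrArg A h
    have h₂ := congrArg B h
    simp [hA₁, hA₂, hB₁, hB₂] at h₁ h₂
    refine ⟨(A x, B x), Subtype.ext ?_⟩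
    change L.mkQ (A x • v₁ + B x • v₂) = L.mkQ x
    congr 1
    apply zsmul_right_injective hk₀
    change k • (A x • v₁ + B x • v₂) = k • x
    rw [← h, smul_add, smul_smul, smul_smul, ← h₁, ← h₂, mul_smul, mul_smul]
  have hker : ρ.ker = π.ker := by
    ext p
    rw [AddMonoidHom.mem_ker, AddMonoidHom.mem_ker]
    have h : π p = ((p.1 : ZMod a), (p.2 : ZMod b)) := rfl
    rw [h, Prod.mk_eq_zero, ZMod.intCast_zmod_eq_zero_iff_dvd, ZMod.intCast_zmod_eq_zero_iff_dvd,
      ← hmem, ← Submodule.Quotient.mk_eq_zero L]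
    exact Subtype.ext_iff
  exact ⟨(QuotientAddGroup.quotientKerEquivOfSurjective ρ hρ_surj).symm.trans
    ((QuotientAddGroup.quotientAddEquivOfEq hker).trans
      (QuotientAddGroup.quotientKerEquivOfSurjective π hπ_surj))⟩

/-- If `gcd(a, b, c) = 1`, then a greatest common divisor `t` of `ab, ac, bc` equals
`gcd(a, b) gcd(a, c) gcd(b, c)`. -/
theorem eq_gcd_mul_gcd_mul_gcd {a b c t : ℕ} (h : Nat.gcd a (Nat.gcd b c) = 1)
    (hab : t ∣ a * b) (hac : t ∣ a * c) (hbc : t ∣ b * c)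
    (ht : ∀ d, d ∣ a * b → d ∣ a * c → d ∣ b * c → d ∣ t) :
    t = Nat.gcd a b * Nat.gcd a c * Nat.gcd b c := by
  have key : Nat.gcd a b * Nat.gcd a c * Nat.gcd b c =
      Nat.gcd (a * b) (Nat.gcd (a * c) (b * c)) := by
    have hcop : Nat.Coprime (Nat.gcd a b) c := by rw [Nat.Coprime, Nat.gcd_assoc, h]
    obtain ⟨a', b', hco, ha, hb⟩ := Nat.exists_coprime a b
    rw [Nat.gcd_mul_right]
    generalize Nat.gcd a b = d at *
    subst ha hb
    rw [hcop.gcd_mul_right_cancel, hcop.gcd_mul_right_cancel, mul_assoc,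
      show a' * d * (b' * d) = d * (a' * b' * d) by ring, Nat.gcd_mul_left,
      hcop.gcd_mul_right_cancel, Nat.gcd_comm (a' * b'), hco.gcd_mul, Nat.gcd_comm c,
      Nat.gcd_comm c]
  rw [key]
  exact Nat.dvd_antisymm (Nat.dvd_gcd hab (Nat.dvd_gcd hac hbc))
    (ht _ (Nat.gcd_dvd_left _ _) ((Nat.gcd_dvd_right _ _).trans (Nat.gcd_dvd_left _ _))
      ((Nat.gcd_dvd_right _ _).trans (Nat.gcd_dvd_right _ _)))

/-- If `gcd(a, b, c) = 1`, then `gcd((x + 1) a, x b, c) = 1` for some integer `x`. -/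
theorem exists_forall_prime_not_dvd {a b c : ℕ} (h : Nat.gcd a (Nat.gcd b c) = 1) :
    ∃ x : ℤ, ∀ p : ℤ, Prime p → p ∣ (x + 1) * a → p ∣ x * b → ¬ p ∣ c := by
  have hcop : IsCoprime ((Nat.gcd b c : ℕ) : ℤ) ((Nat.gcd a c : ℕ) : ℤ) := by
    rw [Nat.isCoprime_iff_coprime]
    apply Nat.Coprime.symm
    exact Nat.Coprime.coprime_dvd_left (Nat.gcd_dvd_left a c) h
  obtain ⟨α, β, hαβ⟩ := hcop
  refine ⟨α * (Nat.gcd b c : ℕ), fun p hp h₁ h₂ h₃ => ?_⟩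
  have hbc (hb : p ∣ b) : p ∣ α * (Nat.gcd b c : ℕ) :=
    Dvd.dvd.mul_left (Int.dvd_coe_gcd hb h₃) _
  rcases hp.dvd_or_dvd h₂ with hx | hb
  · rcases hp.dvd_or_dvd h₁ with hx' | ha
    · exact hp.not_dvd_one ((dvd_add_right hx).1 hx')
    · have hac : p ∣ β * (Nat.gcd a c : ℕ) :=
        Dvd.dvd.mul_left (Int.dvd_coe_gcd ha h₃) _
      exact hp.not_dvd_one (hαβ ▸ dvd_add hx hac)
  · rcases hp.dvd_or_dvd h₁ with hx' | ha
    · exact hp.not_dvd_one ((dvd_add_right (hbc hb)).1 hx')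
    · have : p ∣ ((Nat.gcd a (Nat.gcd b c) : ℕ) : ℤ) :=
        Int.dvd_coe_gcd ha (Int.dvd_coe_gcd hb h₃)
      rw [h] at this
      exact hp.not_dvd_one (by simpa using this)

/-- Smith normal form of the lattice spanned by `u₁ = -a f₀ + b f₁` and `u₂ = -a f₀ + c f₂`, where
`f₀, f₁, f₂` is a basis of a direct summand and `gcd(a, b, c) = 1`. -/
theorem exists_smith_basis {ι : Type*} (f₀ f₁ f₂ : ι → ℤ) (φ₀ φ₁ φ₂ : (ι → ℤ) →ₗ[ℤ] ℤ)
    (h₀₀ : φ₀ f₀ = 1) (h₀₁ : φ₀ f₁ = 0) (h₀₂ : φ₀ f₂ = 0)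
    (h₁₀ : φ₁ f₀ = 0) (h₁₁ : φ₁ f₁ = 1) (h₁₂ : φ₁ f₂ = 0)
    (h₂₀ : φ₂ f₀ = 0) (h₂₁ : φ₂ f₁ = 0) (h₂₂ : φ₂ f₂ = 1)
    {a b c : ℕ} (hb : b ≠ 0) (hc : c ≠ 0) (habc : Nat.gcd a (Nat.gcd b c) = 1)
    {u₁ u₂ : ι → ℤ} (hu₁ : u₁ = -((a : ℤ) • f₀) + (b : ℤ) • f₁)
    (hu₂ : u₂ = -((a : ℤ) • f₀) + (c : ℤ) • f₂) :
    ∃ (v₁ v₂ : ι → ℤ) (A B : (ι → ℤ) →ₗ[ℤ] ℤ) (x k : ℤ),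
      A v₁ = 1 ∧ A v₂ = 0 ∧ B v₁ = 0 ∧ B v₂ = 1 ∧ v₁ = x • u₁ + u₂ ∧
      u₁ = k • v₁ + ((Nat.gcd a b * Nat.gcd a c * Nat.gcd b c : ℕ) : ℤ) • v₂ := by
  obtain ⟨x, hx⟩ := exists_forall_prime_not_dvd habc
  obtain ⟨v₁, hv₁⟩ : ∃ v₁, v₁ = x • u₁ + u₂ := ⟨_, rfl⟩
  have eval_u₁ (φ : (ι → ℤ) →ₗ[ℤ] ℤ) : φ u₁ = -(a * φ f₀) + b * φ f₁ := by
    simp only [hu₁, map_add, map_neg, map_smul, smul_eq_mul]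
  have eval_u₂ (φ : (ι → ℤ) →ₗ[ℤ] ℤ) : φ u₂ = -(a * φ f₀) + c * φ f₂ := by
    simp only [hu₂, map_add, map_neg, map_smul, smul_eq_mul]
  have eval_v₁ (φ : (ι → ℤ) →ₗ[ℤ] ℤ) : φ v₁ = x * φ u₁ + φ u₂ := by
    simp only [hv₁, map_add, map_smul, smul_eq_mul]
  have e₀ : φ₀ v₁ = -((x + 1) * a) := by
    simp only [eval_v₁, eval_u₁, eval_u₂, h₀₀, h₀₁, h₀₂]; ring
  have e₁ : φ₁ v₁ = x * b := by simp [eval_v₁, eval_u₁, eval_u₂, h₁₀, h₁₁, h₁₂]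
  have e₂ : φ₂ v₁ = c := by simp [eval_v₁, eval_u₁, eval_u₂, h₂₀, h₂₁, h₂₂]
  have hv₁0 : v₁ ≠ 0 := by
    rintro rfl
    rw [map_zero] at e₂
    exact hc (by exact_mod_cast e₂.symm)
  obtain ⟨A, hA⟩ : ∃ A : (ι → ℤ) →ₗ[ℤ] ℤ, A v₁ = 1 := by
    obtain ⟨d, w, A, -, hdw, hAw⟩ := exists_eq_smul_dual_apply_eq_one v₁ hv₁0
    have hdvd (φ : (ι → ℤ) →ₗ[ℤ] ℤ) : (d : ℤ) ∣ φ v₁ := ⟨φ w, by rw [hdw, map_smul, smul_eq_mul]⟩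
    have hd : d = 1 := by
      by_contra hd
      obtain ⟨p, hp, hpd⟩ := Nat.exists_prime_and_dvd hd
      have hpd' : (p : ℤ) ∣ d := Int.natCast_dvd_natCast.2 hpd
      refine hx p (Nat.prime_iff_prime_int.1 hp) ?_ ?_ ?_
      · have := hpd'.trans (hdvd φ₀)
        rwa [e₀, dvd_neg] at this
      · exact e₁ ▸ hpd'.trans (hdvd φ₁)
      · exact e₂ ▸ hpd'.trans (hdvd φ₂)
    exact ⟨A, by rw [hdw, hd, Nat.cast_one, one_smul, hAw]⟩
  have hw0 : u₁ - A u₁ • v₁ ≠ 0 := by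
    intro h
    have h₂ := congrArg φ₂ h
    have h₁ := congrArg φ₁ h
    simp only [map_sub, map_smul, map_zero, e₁, e₂, smul_eq_mul] at h₁ h₂
    have hk : A u₁ = 0 := by
      simpa [eval_u₁ φ₂, h₂₀, h₂₁, hc] using h₂
    rw [hk] at h₁
    simp [eval_u₁ φ₁, h₁₀, h₁₁, hb] at h₁
  obtain ⟨t, v₂, B, ht0, hw, hB⟩ := exists_eq_smul_dual_apply_eq_one _ hw0
  have hA₂ : A v₂ = 0 := by
    have h := congrArg A hw
    simpa only [map_sub, map_smul, hA, smul_eq_mul, mul_one, sub_self, zero_eq_mul,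
      Nat.cast_eq_zero, ht0, false_or] using h
  have hu₁v : u₁ = A u₁ • v₁ + (t : ℤ) • v₂ := by rw [← hw]; abel
  have hminor (φ ψ : (ι → ℤ) →ₗ[ℤ] ℤ) :
      φ u₂ * ψ u₁ - φ u₁ * ψ u₂ = t * (φ v₁ * ψ v₂ - φ v₂ * ψ v₁) := by
    have hu₂v : u₂ = v₁ - x • u₁ := by rw [hv₁]; abel
    have hφ₁ := congrArg φ hu₁v
    have hψ₁ := congrArg ψ hu₁v
    have hφ₂ := congrArg φ hu₂v
    have hψ₂ := congrArg ψ hu₂v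
    simp only [map_add, map_sub, map_smul, smul_eq_mul] at hφ₁ hψ₁ hφ₂ hψ₂
    rw [hφ₂, hψ₂]
    linear_combination φ v₁ * hψ₁ - ψ v₁ * hφ₁
  have ht : t = Nat.gcd a b * Nat.gcd a c * Nat.gcd b c := by
    apply eq_gcd_mul_gcd_mul_gcd habc
    · have h := Dvd.intro _ (hminor φ₁ φ₀).symm
      simp [eval_u₁, eval_u₂, h₀₀, h₀₁, h₀₂, h₁₀, h₁₁, h₁₂] at h
      rw [mul_comm]
      exact_mod_cast h
    · have h := Dvd.intro _ (hminor φ₂ φ₀).symm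
      simp [eval_u₁, eval_u₂, h₀₀, h₀₁, h₀₂, h₂₀, h₂₁, h₂₂] at h
      rw [mul_comm]
      exact_mod_cast h
    · have h := Dvd.intro _ (hminor φ₂ φ₁).symm
      simp [eval_u₁, eval_u₂, h₂₀, h₂₁, h₂₂, h₁₀, h₁₁, h₁₂] at h
      rw [mul_comm]
      exact_mod_cast h
    · intro d hab hac hbc
      obtain ⟨r, hr⟩ := Int.natCast_dvd_natCast.2 hab
      obtain ⟨s, hs⟩ := Int.natCast_dvd_natCast.2 hac
      obtain ⟨q, hq⟩ := Int.natCast_dvd_natCast.2 hbc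
      push_cast at hr hs hq
      have h := hminor A B
      rw [hA, hB, hA₂, eval_u₁, eval_u₁, eval_u₂, eval_u₂] at h
      refine Int.natCast_dvd_natCast.1
        ⟨r * (A f₁ * B f₀ - A f₀ * B f₁) + s * (A f₀ * B f₂ - A f₂ * B f₀) +
          q * (A f₂ * B f₁ - A f₁ * B f₂), ?_⟩
      linear_combination -h + (A f₁ * B f₀ - A f₀ * B f₁) * hr +
        (A f₀ * B f₂ - A f₂ * B f₀) * hs + (A f₂ * B f₁ - A f₁ * B f₂) * hq
  refine ⟨v₁, v₂, A, B - B v₁ • A, x, A u₁, hA, hA₂, ?_, ?_, hv₁, ht ▸ hu₁v⟩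
  · simp [hA]
  · simp [hA₂, hB]


/-- The torsion subgroup of `ℤ^n / ⟨u_1, u_2⟩`, where `u_1 = (−l_0, l_1, 0)` and
`u_2 = (−l_0, 0, l_2)` in block notation, is isomorphic to
`ℤ/𝔩 × ℤ/(𝔩·𝔩_{01}·𝔩_{02}·𝔩_{12})`. -/
theorem torsion_of_trinomial_grading_group
    (n0 n1 n2 : ℕ) (hn0 : 1 ≤ n0) (hn1 : 1 ≤ n1) (hn2 : 1 ≤ n2)
    (l0 : Fin n0 → ℕ) (l1 : Fin n1 → ℕ) (l2 : Fin n2 → ℕ)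
    (hl0 : ∀ j, 0 < l0 j) (hl1 : ∀ j, 0 < l1 j) (hl2 : ∀ j, 0 < l2 j)
    (u1 u2 : (Fin n0 ⊕ Fin n1 ⊕ Fin n2) → ℤ)
    (hu1 : u1 = Sum.elim (fun j => -(l0 j : ℤ))
      (Sum.elim (fun j => (l1 j : ℤ)) (fun _ => 0)))
    (hu2 : u2 = Sum.elim (fun j => -(l0 j : ℤ))
      (Sum.elim (fun _ => 0) (fun j => (l2 j : ℤ))))
    (g0 g1 g2 g : ℕ)
    (hg0 : g0 = Finset.univ.gcd l0) (hg1 : g1 = Finset.univ.gcd l1)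
    (hg2 : g2 = Finset.univ.gcd l2)
    (hg : g = Nat.gcd g0 (Nat.gcd g1 g2))
    (g01 g02 g12 : ℕ)
    (h01 : g01 = Nat.gcd (g0 / g) (g1 / g))
    (h02 : g02 = Nat.gcd (g0 / g) (g2 / g))
    (h12 : g12 = Nat.gcd (g1 / g) (g2 / g)) :
    Nonempty
      ((Submodule.torsion ℤ
          (((Fin n0 ⊕ Fin n1 ⊕ Fin n2) → ℤ) ⧸
            Submodule.span ℤ ({u1, u2} : Set ((Fin n0 ⊕ Fin n1 ⊕ Fin n2) → ℤ)))) ≃+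
        (ZMod g × ZMod (g * g01 * g02 * g12))) := by
  have hg0p : g0 ≠ 0 := by
    rw [hg0, Ne, Finset.gcd_eq_zero_iff]
    exact fun h => (hl0 ⟨0, hn0⟩).ne' (h _ (Finset.mem_univ _))
  have hg1p : g1 ≠ 0 := by
    rw [hg1, Ne, Finset.gcd_eq_zero_iff]
    exact fun h => (hl1 ⟨0, hn1⟩).ne' (h _ (Finset.mem_univ _))
  have hg2p : g2 ≠ 0 := by
    rw [hg2, Ne, Finset.gcd_eq_zero_iff]
    exact fun h => (hl2 ⟨0, hn2⟩).ne' (h _ (Finset.mem_univ _))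
  obtain ⟨f0, ψ0, hf0, hψ0⟩ := exists_eq_gcd_smul_dual_apply_eq_one l0
    (fun h => (hl0 ⟨0, hn0⟩).ne' (congrFun h _))
  obtain ⟨f1, ψ1, hf1, hψ1⟩ := exists_eq_gcd_smul_dual_apply_eq_one l1
    (fun h => (hl1 ⟨0, hn1⟩).ne' (congrFun h _))
  obtain ⟨f2, ψ2, hf2, hψ2⟩ := exists_eq_gcd_smul_dual_apply_eq_one l2
    (fun h => (hl2 ⟨0, hn2⟩).ne' (congrFun h _))
  rw [← hg0] at hf0
  rw [← hg1] at hf1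
  rw [← hg2] at hf2
  have hgp : 0 < g := hg ▸ Nat.gcd_pos_of_pos_left _ (Nat.pos_of_ne_zero hg0p)
  have hgg0 : g ∣ g0 := hg ▸ Nat.gcd_dvd_left _ _
  have hgg1 : g ∣ g1 := hg ▸ (Nat.gcd_dvd_right _ _).trans (Nat.gcd_dvd_left _ _)
  have hgg2 : g ∣ g2 := hg ▸ (Nat.gcd_dvd_right _ _).trans (Nat.gcd_dvd_right _ _)
  obtain ⟨a, ha⟩ := hgg0
  obtain ⟨b, hb⟩ := hgg1
  obtain ⟨c, hc⟩ := hgg2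
  have ha0 : a ≠ 0 := by rintro rfl; exact hg0p ha
  have hb0 : b ≠ 0 := by rintro rfl; exact hg1p hb
  have hc0 : c ≠ 0 := by rintro rfl; exact hg2p hc
  have habc : Nat.gcd a (Nat.gcd b c) = 1 := by
    rw [ha, hb, hc, Nat.gcd_mul_left, Nat.gcd_mul_left] at hg
    exact Nat.eq_of_mul_eq_mul_left hgp (by rw [mul_one]; exact hg.symm)
  rw [ha, Nat.mul_div_cancel_left _ hgp] at h01 h02
  rw [hb, Nat.mul_div_cancel_left _ hgp] at h01 h12
  rw [hc, Nat.mul_div_cancel_left _ hgp] at h02 h12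
  let R0 := LinearMap.funLeft ℤ ℤ (Sum.inl : Fin n0 → Fin n0 ⊕ Fin n1 ⊕ Fin n2)
  let R1 := LinearMap.funLeft ℤ ℤ (Sum.inr ∘ Sum.inl : Fin n1 → Fin n0 ⊕ Fin n1 ⊕ Fin n2)
  let R2 := LinearMap.funLeft ℤ ℤ (Sum.inr ∘ Sum.inr : Fin n2 → Fin n0 ⊕ Fin n1 ⊕ Fin n2)
  let F0 : Fin n0 ⊕ Fin n1 ⊕ Fin n2 → ℤ := Sum.elim f0 0
  let F1 : Fin n0 ⊕ Fin n1 ⊕ Fin n2 → ℤ := Sum.elim 0 (Sum.elim f1 0)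
  let F2 : Fin n0 ⊕ Fin n1 ⊕ Fin n2 → ℤ := Sum.elim 0 (Sum.elim 0 f2)
  obtain ⟨v₁, v₂, A, B, x, k, hA₁, hA₂, hB₁, hB₂, hv₁, hw⟩ :=
    exists_smith_basis F0 F1 F2 (ψ0 ∘ₗ R0) (ψ1 ∘ₗ R1) (ψ2 ∘ₗ R2)
      hψ0 (map_zero ψ0) (map_zero ψ0) (map_zero ψ1) hψ1 (map_zero ψ1)
      (map_zero ψ2) (map_zero ψ2) hψ2 hb0 hc0 habc rfl rfl
  rw [← h01, ← h02, ← h12] at hw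
  have hu1' : u1 = (g : ℤ) • (-((a : ℤ) • F0) + (b : ℤ) • F1) := by
    rw [hu1]
    ext (j | j | j)
    · have h := congrFun hf0 j
      simp [F0, F1, h, ha, mul_assoc]
    · have h := congrFun hf1 j
      simp [F0, F1, h, hb, mul_assoc]
    · simp [F0, F1]
  have hu2' : u2 = (g : ℤ) • (-((a : ℤ) • F0) + (c : ℤ) • F2) := by
    rw [hu2]
    ext (j | j | j)
    · have h := congrFun hf0 j
      simp [F0, F2, h, ha, mul_assoc]
    · simp [F0, F2]
    · have h := congrFun hf2 j
      simp [F0, F2, h, hc, mul_assoc]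
  generalize -((a : ℤ) • F0) + (b : ℤ) • F1 = w₁ at *
  generalize -((a : ℤ) • F0) + (c : ℤ) • F2 = w₂ at *
  have hspan : Submodule.span ℤ ({u1, u2} : Set (Fin n0 ⊕ Fin n1 ⊕ Fin n2 → ℤ)) =
      Submodule.span ℤ {(g : ℤ) • v₁, ((g * g01 * g02 * g12 : ℕ) : ℤ) • v₂} := by
    have hN : ((g * g01 * g02 * g12 : ℕ) : ℤ) • v₂ = (g : ℤ) • (w₁ - k • v₁) := by
      rw [← eq_sub_of_add_eq' hw.symm, smul_smul]
      push_cast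
      simp only [mul_assoc]
    have hw₂ : w₂ = v₁ - x • w₁ := eq_sub_of_add_eq' hv₁.symm
    apply le_antisymm <;> rw [Submodule.span_le, Set.pair_subset_iff] <;>
      simp only [SetLike.mem_coe, Submodule.mem_span_pair]
    · rw [hN, hu1', hu2', hw₂]
      exact ⟨⟨k, 1, by module⟩, ⟨1 - x * k, -x, by module⟩⟩
    · rw [hN, hu1', hu2', hw₂]
      exact ⟨⟨x, 1, by module⟩, ⟨1 - k * x, -k, by module⟩⟩
  have hN0 : g * g01 * g02 * g12 ≠ 0 := by
    have h1 : 0 < g01 := h01 ▸ Nat.gcd_pos_of_pos_left _ (Nat.pos_of_ne_zero ha0)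
    have h2 : 0 < g02 := h02 ▸ Nat.gcd_pos_of_pos_left _ (Nat.pos_of_ne_zero ha0)
    have h3 : 0 < g12 := h12 ▸ Nat.gcd_pos_of_pos_left _ (Nat.pos_of_ne_zero hb0)
    positivity
  rw [hspan]
  exact nonempty_torsion_quotient_span_pair_addEquiv v₁ v₂ A B hA₁ hA₂ hB₁ hB₂ _ _ hgp.ne' hN0
end

section
/- For each polynomial f in the list T_1² + T_2³ + T_3⁵, T_1² + T_2³ + T_3³T_4, T_1² + T_2³ + T_3²T_4³, T_1² + T_2³ + T_3T_4⁴, the quotient ring ℂ[T_1, T_2, T_3, T_4]/⟨f⟩ is an integral domain which is factorial, i.e., a unique factorization domain. -/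
open MvPolynomial

theorem Polynomial.irreducible_X_sq_add_C_X_cube_add_C {D : Type*} [CommRing D] [IsDomain D]
    (d : D) :
    Irreducible (X ^ 2 + C (X ^ 3 + C d) : Polynomial (Polynomial D)) := by
  have hdeg : (X ^ 2 + C (X ^ 3 + C d) : Polynomial (Polynomial D)).natDegree = 2 :=
    natDegree_X_pow_add_C
  rw [Monic.irreducible_iff_roots_eq_zero_of_degree_le_three
    (monic_X_pow_add_C _ two_ne_zero) hdeg.ge (by omega)]
  refine Multiset.eq_zero_of_forall_notMem fun r hr ↦ ?_
  have h : r ^ 2 + (X ^ 3 + C d) = 0 := by simpa using (mem_roots'.1 hr).2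
  have h3 : (X ^ 3 + C d : Polynomial D).natDegree = 3 := natDegree_X_pow_add_C
  rw [← neg_eq_of_add_eq_zero_right h, natDegree_neg, natDegree_pow] at h3
  omega

namespace MvPolynomial

theorem prime_X_sq_add_X_cube_add_rename {K : Type*} [Field K] {n : ℕ}
    (d : MvPolynomial (Fin n) K) :
    Prime (X 0 ^ 2 + X 1 ^ 3 + rename (fun i ↦ i.succ.succ) d : MvPolynomial (Fin (n + 2)) K) := by
  let e : MvPolynomial (Fin (n + 2)) K ≃ₐ[K] Polynomial (Polynomial (MvPolynomial (Fin n) K)) :=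
    (finSuccEquiv K (n + 1)).trans (Polynomial.mapAlgEquiv (finSuccEquiv K n))
  refine comap_prime e e.symm (fun a ↦ by simp) ?_
  have hd : e (rename (fun i ↦ i.succ.succ) d) = Polynomial.C (Polynomial.C d) := by
    induction d using MvPolynomial.induction_on with
    | C a => simp [e, finSuccEquiv_apply]
    | add p q hp hq => simp only [map_add, hp, hq]
    | mul_X p i hp => simp only [map_mul, hp]; simp [e, finSuccEquiv_X_succ]
  have h1 : e (X 1) = Polynomial.C Polynomial.X := by
    have h := finSuccEquiv_X_succ (R := K) (j := (0 : Fin (n + 1)))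
    rw [Fin.succ_zero_eq_one] at h
    simp [e, h, finSuccEquiv_X_zero]
  have h0 : e (X 0) = Polynomial.X := by simp [e, finSuccEquiv_X_zero]
  rw [map_add, map_add, map_pow, map_pow, hd, h0, h1, add_assoc, ← map_pow, ← map_add]
  exact (Polynomial.irreducible_X_sq_add_C_X_cube_add_C d).prime

section SetVariableZero

variable {σ K : Type*} [DecidableEq σ] [CommRing K]

theorem X_dvd_sub_aeval_update (i : σ) (p : MvPolynomial σ K) :
    X i ∣ p - aeval (Function.update X i 0 : σ → MvPolynomial σ K) p := by
  rw [← Ideal.mem_span_singleton, ← Ideal.Quotient.eq]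
  let m := Ideal.Quotient.mkₐ K (Ideal.span {(X i : MvPolynomial σ K)})
  suffices m = m.comp (aeval (Function.update X i 0)) from DFunLike.congr_fun this p
  ext j
  by_cases hj : j = i
  · subst hj
    simp [m]
  · simp [hj]

variable {i : σ} {f g : MvPolynomial σ K}

theorem mk_X_dvd_mk_iff (hfg : aeval (Function.update X i 0 : σ → MvPolynomial σ K) f = g)
    (p : MvPolynomial σ K) :
    Ideal.Quotient.mk (Ideal.span {f}) (X i) ∣ Ideal.Quotient.mk (Ideal.span {f}) p ↔
      g ∣ aeval (Function.update X i 0 : σ → MvPolynomial σ K) p := by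
  constructor
  · rintro ⟨k, hk⟩
    obtain ⟨k, rfl⟩ := Ideal.Quotient.mk_surjective k
    rw [← map_mul, Ideal.Quotient.eq, Ideal.mem_span_singleton] at hk
    have h := map_dvd (aeval (Function.update X i 0 : σ → MvPolynomial σ K)) hk
    rw [map_sub, map_mul, aeval_X, Function.update_self, zero_mul, sub_zero, hfg] at h
    exact h
  · rintro ⟨k, hk⟩
    have h1 := X_dvd_sub_aeval_update i p
    have h2 := X_dvd_sub_aeval_update i f
    rw [hk] at h1
    rw [hfg] at h2
    have h3 := map_dvd (Ideal.Quotient.mk (Ideal.span {f})) (dvd_sub h1 (h2.mul_right k))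
    have hf : Ideal.Quotient.mk (Ideal.span {f}) f = 0 :=
      Ideal.Quotient.eq_zero_iff_mem.2 (Ideal.mem_span_singleton_self f)
    rwa [show p - g * k - (f - g) * k = p - f * k by ring, map_sub, map_mul, hf, zero_mul,
      sub_zero] at h3

theorem prime_mk_X [IsDomain K]
    (hfg : aeval (Function.update X i 0 : σ → MvPolynomial σ K) f = g)
    (hg : Prime g) : Prime (Ideal.Quotient.mk (Ideal.span {f}) (X i)) := by
  refine ⟨fun h ↦ ?_, fun h ↦ ?_, fun a b hab ↦ ?_⟩
  · rw [Ideal.Quotient.eq_zero_iff_mem, Ideal.mem_span_singleton] at h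
    obtain ⟨k, hk⟩ := h
    have h0 := congrArg (aeval (Function.update X i 0 : σ → MvPolynomial σ K)) hk
    simp only [map_mul, aeval_X, Function.update_self, hfg] at h0
    have hk0 := (mul_eq_zero.1 h0.symm).resolve_left hg.ne_zero
    obtain ⟨l, rfl⟩ : X i ∣ k := by
      simpa only [hk0, sub_zero] using X_dvd_sub_aeval_update i k
    have hu : f * l = 1 := mul_left_cancel₀ (X_ne_zero i) (by rw [mul_one]; nth_rw 2 [hk]; ring)
    refine hg.not_isUnit (hfg ▸ (IsUnit.of_mul_eq_one l hu).map _)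
  · have h1 := isUnit_iff_dvd_one.1 h
    rw [← map_one (Ideal.Quotient.mk (Ideal.span {f})), mk_X_dvd_mk_iff hfg, map_one] at h1
    exact hg.not_isUnit (isUnit_of_dvd_one h1)
  · obtain ⟨a, rfl⟩ := Ideal.Quotient.mk_surjective a
    obtain ⟨b, rfl⟩ := Ideal.Quotient.mk_surjective b
    rw [← map_mul, mk_X_dvd_mk_iff hfg, map_mul] at hab
    rw [mk_X_dvd_mk_iff hfg, mk_X_dvd_mk_iff hfg]
    exact hg.dvd_or_dvd hab

end SetVariableZero

/-- Two localizations of algebras are isomorphic if each of the algebras maps compatibly to the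
localization of the other one. -/
theorem _root_.IsLocalization.Away.nonempty_algEquiv {K R T S A : Type*} [CommRing K] [CommRing R]
    [CommRing T] [CommRing S] [CommRing A] [Algebra K R] [Algebra K T] [Algebra K S] [Algebra K A]
    [Algebra R S] [Algebra T A] [IsScalarTower K R S] [IsScalarTower K T A] (z : R) (q : T)
    [IsLocalization.Away z S] [IsLocalization.Away q A] (φ₀ : R →ₐ[K] A) (θ₀ : T →ₐ[K] S)
    (hz : IsUnit (φ₀ z)) (hq : IsUnit (θ₀ q))
    (hθ : ∀ θ : A →ₐ[K] S, (∀ t, θ (algebraMap T A t) = θ₀ t) → ∀ r, θ (φ₀ r) = algebraMap R S r)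
    (hφ : ∀ φ : S →ₐ[K] A, (∀ r, φ (algebraMap R S r) = φ₀ r) →
      ∀ t, φ (θ₀ t) = algebraMap T A t) :
    Nonempty (A ≃ₐ[K] S) := by
  let φ : S →ₐ[K] A := IsLocalization.Away.liftAlgHom z hz
  let θ : A →ₐ[K] S := IsLocalization.Away.liftAlgHom q hq
  have hφ₀ (r : R) : φ (algebraMap R S r) = φ₀ r :=
    IsLocalization.Away.lift_eq (g := (φ₀ : R →+* A)) z hz r
  have hθ₀ (t : T) : θ (algebraMap T A t) = θ₀ t :=
    IsLocalization.Away.lift_eq (g := (θ₀ : T →+* S)) q hq t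
  refine ⟨AlgEquiv.ofAlgHom θ φ ?_ ?_⟩
  · apply AlgHom.coe_ringHom_injective
    apply IsLocalization.ringHom_ext (Submonoid.powers z)
    ext r
    simpa [hφ₀] using hθ θ hθ₀ r
  · apply AlgHom.coe_ringHom_injective
    apply IsLocalization.ringHom_ext (Submonoid.powers q)
    ext t
    simpa [hθ₀] using hφ φ hφ₀ t

section Chart

variable {K σ τ S A : Type*} [Field K] [CommRing S] [CommRing A] [Algebra K S] [Algebra K A]
  {f z : MvPolynomial σ K} {q : MvPolynomial τ K} [Algebra (MvPolynomial σ K ⧸ Ideal.span {f}) S]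
  [IsScalarTower K (MvPolynomial σ K ⧸ Ideal.span {f}) S] [Algebra (MvPolynomial τ K) A]
  [IsScalarTower K (MvPolynomial τ K) A]

/-- A localized hypersurface is isomorphic to a localized polynomial ring if the images of the
variables in both directions are compatible. -/
theorem nonempty_algEquiv_away_quotient
    [IsLocalization.Away (Ideal.Quotient.mk (Ideal.span {f}) z) S] [IsLocalization.Away q A]
    (a : σ → A) (s : τ → S)
    (hf : aeval a f = 0) (hz : IsUnit (aeval a z)) (hq : IsUnit (aeval s q))
    (ha : ∀ θ : A →ₐ[K] S, (∀ p, θ (algebraMap (MvPolynomial τ K) A p) = aeval s p) →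
      ∀ i, θ (a i) = algebraMap _ S (Ideal.Quotient.mk (Ideal.span {f}) (X i)))
    (hs : ∀ φ : S →ₐ[K] A,
      (∀ p, φ (algebraMap _ S (Ideal.Quotient.mk (Ideal.span {f}) p)) = aeval a p) →
        ∀ j, φ (s j) = algebraMap (MvPolynomial τ K) A (X j)) :
    Nonempty (A ≃ₐ[K] S) := by
  let φ₀ : (MvPolynomial σ K ⧸ Ideal.span {f}) →ₐ[K] A :=
    Ideal.Quotient.liftₐ _ (aeval a) fun p hp ↦ by
      obtain ⟨k, rfl⟩ := Ideal.mem_span_singleton.1 hp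
      rw [map_mul, hf, zero_mul]
  refine IsLocalization.Away.nonempty_algEquiv (Ideal.Quotient.mk (Ideal.span {f}) z) q
    φ₀ (aeval s) hz hq (fun θ hθ ↦ ?_) (fun φ hφ ↦ ?_)
  · rw [(Ideal.Quotient.mk_surjective (I := Ideal.span {f})).forall]
    have : θ.comp (aeval a) = (IsScalarTower.toAlgHom K (MvPolynomial σ K ⧸ Ideal.span {f}) S).comp
        (Ideal.Quotient.mkₐ K _) :=
      MvPolynomial.algHom_ext fun i ↦ by simpa using ha θ hθ i
    exact fun p ↦ DFunLike.congr_fun this p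
  · have : φ.comp (aeval s) = IsScalarTower.toAlgHom K (MvPolynomial τ K) A :=
      MvPolynomial.algHom_ext fun j ↦ by simpa using hs φ (fun p ↦ hφ _) j
    exact DFunLike.congr_fun this

end Chart

end MvPolynomial

/-- Nagata's criterion for the localization at a product of two primes. -/
theorem UniqueFactorizationMonoid.of_isLocalizationAway_mul {R : Type*} [CommRing R] [IsDomain R]
    [IsNoetherianRing R] {x y : R} (hx : Prime x) (hy : Prime y) (hyx : ¬ y ∣ x)
    (S : Type*) [CommRing S] [Algebra R S] [IsLocalization.Away (x * y) S]
    [UniqueFactorizationMonoid S] : UniqueFactorizationMonoid R := by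
  rw [iff_localizationAway_of_prime hx]
  have : IsDomain (Localization.Away x) := IsLocalization.Away.isDomain _ hx.ne_zero
  have : IsNoetherianRing (Localization.Away x) :=
    IsLocalization.isNoetherianRing (Submonoid.powers x) _ inferInstance
  have hy' : Prime (algebraMap R (Localization.Away x) y) := by
    have hp : (Ideal.span {y}).IsPrime := (Ideal.span_singleton_prime hy.ne_zero).2 hy
    have h := IsLocalization.isPrime_of_isPrime_disjoint (Submonoid.powers x)
      (Localization.Away x) _ hp
      ((Ideal.disjoint_powers_iff_notMem_of_isPrime x).2 (by rwa [Ideal.mem_span_singleton]))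
    rw [Ideal.map_span, Set.image_singleton, Ideal.span_singleton_prime] at h
    · exact h
    · rw [Ne, IsLocalization.to_map_eq_zero_iff _
        (powers_le_nonZeroDivisors_of_noZeroDivisors hx.ne_zero)]
      exact hy.ne_zero
  rw [iff_localizationAway_of_prime hy']
  have : IsLocalization.Away (x * y) (Localization.Away (algebraMap R (Localization.Away x) y)) :=
    IsLocalization.Away.mul' (Localization.Away x) _ x y
  exact (IsLocalization.algEquiv (Submonoid.powers (x * y)) S
    (Localization.Away (algebraMap R (Localization.Away x) y))).toMulEquiv.uniqueFactorizationMonoid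
      ‹_›

/-- `X₀² + X₁³` as a polynomial in four variables. -/
local notation "cusp" => (X 0 ^ 2 + X 1 ^ 3 : MvPolynomial (Fin 4) ℂ)

theorem prime_cusp : Prime cusp := by
  simpa using MvPolynomial.prime_X_sq_add_X_cube_add_rename (0 : MvPolynomial (Fin 2) ℂ)

theorem MvPolynomial.isDomain_quotient_span {σ K : Type*} [Field K] {f : MvPolynomial σ K}
    (hf : Prime f) : IsDomain (MvPolynomial σ K ⧸ Ideal.span {f}) :=
  (Ideal.Quotient.isDomain_iff_prime _).2 ((Ideal.span_singleton_prime hf.ne_zero).2 hf)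

section Charts

variable {S A : Type*} [CommRing S] [CommRing A] [Algebra ℂ S] [Algebra ℂ A]
  [Algebra (MvPolynomial (Fin 3) ℂ) A] [IsScalarTower ℂ (MvPolynomial (Fin 3) ℂ) A]

/-- The chart of the hypersurface with `X 2` invertible. -/
theorem nonempty_algEquiv_fifth_power
    [Algebra (MvPolynomial (Fin 4) ℂ ⧸ Ideal.span {cusp + X 2 ^ 5}) S]
    [IsScalarTower ℂ (MvPolynomial (Fin 4) ℂ ⧸ Ideal.span {cusp + X 2 ^ 5}) S]
    [IsLocalization.Away (Ideal.Quotient.mk (Ideal.span {cusp + X 2 ^ 5}) (X 2)) S]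
    [IsLocalization.Away (X 0 ^ 2 + X 1 ^ 3 : MvPolynomial (Fin 3) ℂ) A] :
    Nonempty (A ≃ₐ[ℂ] S) := by
  let ι : MvPolynomial (Fin 4) ℂ →+* S :=
    (algebraMap _ S).comp (Ideal.Quotient.mk (Ideal.span {cusp + X 2 ^ 5}))
  let κ := algebraMap (MvPolynomial (Fin 3) ℂ) A
  have hf : ι (cusp + X 2 ^ 5) = 0 := by
    simp only [ι, RingHom.comp_apply, Ideal.Quotient.mk_singleton_self, map_zero]
  obtain ⟨v, hv⟩ : ∃ v, ι (X 2) * v = 1 := (IsLocalization.Away.algebraMap_isUnit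
    (Ideal.Quotient.mk (Ideal.span {cusp + X 2 ^ 5}) (X 2))).exists_right_inv
  obtain ⟨u, hu⟩ : ∃ u, κ (X 0 ^ 2 + X 1 ^ 3) * u = 1 :=
    (IsLocalization.Away.algebraMap_isUnit _).exists_right_inv
  simp only [map_add, map_pow] at hf hu
  refine nonempty_algEquiv_away_quotient (f := cusp + X 2 ^ 5) (z := X 2)
    (q := X 0 ^ 2 + X 1 ^ 3)
    ![-κ (X 0) * u ^ 3, κ (X 1) * u ^ 2, -u, κ (X 2)]
    ![ι (X 0) * v ^ 3, ι (X 1) * v ^ 2, ι (X 3)]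
    ?_ ?_ ?_ (fun θ hθ ↦ ?_) (fun φ hφ ↦ ?_)
  · simp only [map_add, map_pow, aeval_X]
    change (-κ (X 0) * u ^ 3) ^ 2 + (κ (X 1) * u ^ 2) ^ 3 + (-u) ^ 5 = 0
    linear_combination u ^ 5 * hu
  · rw [aeval_X]
    exact (IsUnit.of_mul_eq_one_right _ hu).neg
  · simp only [map_add, map_pow, aeval_X]
    change IsUnit ((ι (X 0) * v ^ 3) ^ 2 + (ι (X 1) * v ^ 2) ^ 3)
    refine IsUnit.of_mul_eq_one (-ι (X 2)) ?_
    grind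
  · change ∀ p, θ (κ p) = _ at hθ
    change ∀ i, _ = ι (X i)
    have h := congrArg θ hu
    simp [hθ] at h
    have hu' : θ u = -ι (X 2) := by grind
    simp [Fin.forall_fin_succ, hθ, hu']
    grind
  · change ∀ p, φ (ι p) = _ at hφ
    change ∀ j, _ = κ (X j)
    have h := congrArg φ hv
    simp [hφ] at h
    have hv' : φ v = -(κ (X 0) ^ 2 + κ (X 1) ^ 3) := by grind
    simp [Fin.forall_fin_succ, hφ, hv']
    grind

/-- The chart of the hypersurface with `X 2` invertible. -/
theorem nonempty_algEquiv_cube_mul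
    [Algebra (MvPolynomial (Fin 4) ℂ ⧸ Ideal.span {cusp + X 2 ^ 3 * X 3}) S]
    [IsScalarTower ℂ (MvPolynomial (Fin 4) ℂ ⧸ Ideal.span {cusp + X 2 ^ 3 * X 3}) S]
    [IsLocalization.Away (Ideal.Quotient.mk (Ideal.span {cusp + X 2 ^ 3 * X 3}) (X 2)) S]
    [IsLocalization.Away (X 2 : MvPolynomial (Fin 3) ℂ) A] :
    Nonempty (A ≃ₐ[ℂ] S) := by
  let ι : MvPolynomial (Fin 4) ℂ →+* S :=
    (algebraMap _ S).comp (Ideal.Quotient.mk (Ideal.span {cusp + X 2 ^ 3 * X 3}))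
  let κ := algebraMap (MvPolynomial (Fin 3) ℂ) A
  have hf : ι (cusp + X 2 ^ 3 * X 3) = 0 := by
    simp only [ι, RingHom.comp_apply, Ideal.Quotient.mk_singleton_self, map_zero]
  obtain ⟨v, hv⟩ : ∃ v, ι (X 2) * v = 1 := (IsLocalization.Away.algebraMap_isUnit
    (Ideal.Quotient.mk (Ideal.span {cusp + X 2 ^ 3 * X 3}) (X 2))).exists_right_inv
  obtain ⟨u, hu⟩ : ∃ u, κ (X 2) * u = 1 :=
    (IsLocalization.Away.algebraMap_isUnit _).exists_right_inv
  simp only [map_add, map_mul, map_pow] at hf hu hv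
  refine nonempty_algEquiv_away_quotient (f := cusp + X 2 ^ 3 * X 3) (z := X 2)
    (q := X 2)
    ![κ (X 0), κ (X 1), κ (X 2), -(κ (X 0) ^ 2 + κ (X 1) ^ 3) * u ^ 3]
    ![ι (X 0), ι (X 1), ι (X 2)]
    ?_ ?_ ?_ (fun θ hθ ↦ ?_) (fun φ hφ ↦ ?_)
  · simp only [map_add, map_mul, map_pow, aeval_X]
    change κ (X 0) ^ 2 + κ (X 1) ^ 3 + κ (X 2) ^ 3 * (-(κ (X 0) ^ 2 + κ (X 1) ^ 3) * u ^ 3) = 0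
    grind
  · rw [aeval_X]
    exact IsUnit.of_mul_eq_one _ hu
  · rw [aeval_X]
    exact IsUnit.of_mul_eq_one _ hv
  · change ∀ p, θ (κ p) = _ at hθ
    change ∀ i, _ = ι (X i)
    have h := congrArg θ hu
    simp [hθ] at h
    have hu' : θ u = v := by grind
    simp [Fin.forall_fin_succ, hθ, hu']
    grind
  · change ∀ p, φ (ι p) = _ at hφ
    change ∀ j, _ = κ (X j)
    simp [Fin.forall_fin_succ, hφ]

/-- The chart of the hypersurface with `X 3` invertible. -/
theorem nonempty_algEquiv_mul_fourth_power
    [Algebra (MvPolynomial (Fin 4) ℂ ⧸ Ideal.span {cusp + X 2 * X 3 ^ 4}) S]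
    [IsScalarTower ℂ (MvPolynomial (Fin 4) ℂ ⧸ Ideal.span {cusp + X 2 * X 3 ^ 4}) S]
    [IsLocalization.Away (Ideal.Quotient.mk (Ideal.span {cusp + X 2 * X 3 ^ 4}) (X 3)) S]
    [IsLocalization.Away (X 2 : MvPolynomial (Fin 3) ℂ) A] :
    Nonempty (A ≃ₐ[ℂ] S) := by
  let ι : MvPolynomial (Fin 4) ℂ →+* S :=
    (algebraMap _ S).comp (Ideal.Quotient.mk (Ideal.span {cusp + X 2 * X 3 ^ 4}))
  let κ := algebraMap (MvPolynomial (Fin 3) ℂ) A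
  have hf : ι (cusp + X 2 * X 3 ^ 4) = 0 := by
    simp only [ι, RingHom.comp_apply, Ideal.Quotient.mk_singleton_self, map_zero]
  obtain ⟨v, hv⟩ : ∃ v, ι (X 3) * v = 1 := (IsLocalization.Away.algebraMap_isUnit
    (Ideal.Quotient.mk (Ideal.span {cusp + X 2 * X 3 ^ 4}) (X 3))).exists_right_inv
  obtain ⟨u, hu⟩ : ∃ u, κ (X 2) * u = 1 :=
    (IsLocalization.Away.algebraMap_isUnit _).exists_right_inv
  simp only [map_add, map_mul, map_pow] at hf hu hv
  refine nonempty_algEquiv_away_quotient (f := cusp + X 2 * X 3 ^ 4) (z := X 3)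
    (q := X 2)
    ![κ (X 0), κ (X 1), -(κ (X 0) ^ 2 + κ (X 1) ^ 3) * u ^ 4, κ (X 2)]
    ![ι (X 0), ι (X 1), ι (X 3)]
    ?_ ?_ ?_ (fun θ hθ ↦ ?_) (fun φ hφ ↦ ?_)
  · simp only [map_add, map_mul, map_pow, aeval_X]
    change κ (X 0) ^ 2 + κ (X 1) ^ 3 + (-(κ (X 0) ^ 2 + κ (X 1) ^ 3) * u ^ 4) * κ (X 2) ^ 4 = 0
    grind
  · rw [aeval_X]
    exact IsUnit.of_mul_eq_one _ hu
  · rw [aeval_X]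
    exact IsUnit.of_mul_eq_one _ hv
  · change ∀ p, θ (κ p) = _ at hθ
    change ∀ i, _ = ι (X i)
    have h := congrArg θ hu
    simp [hθ] at h
    have hu' : θ u = v := by grind
    simp [Fin.forall_fin_succ, hθ, hu']
    grind
  · change ∀ p, φ (ι p) = _ at hφ
    change ∀ j, _ = κ (X j)
    simp [Fin.forall_fin_succ, hφ]

/-- The chart of the hypersurface with `X 2` and `X 3` invertible. -/
theorem nonempty_algEquiv_sq_mul_cube
    [Algebra (MvPolynomial (Fin 4) ℂ ⧸ Ideal.span {cusp + X 2 ^ 2 * X 3 ^ 3}) S]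
    [IsScalarTower ℂ (MvPolynomial (Fin 4) ℂ ⧸ Ideal.span {cusp + X 2 ^ 2 * X 3 ^ 3}) S]
    [IsLocalization.Away (Ideal.Quotient.mk (Ideal.span {cusp + X 2 ^ 2 * X 3 ^ 3}) (X 2 * X 3)) S]
    [IsLocalization.Away (X 2 * (X 0 ^ 2 + X 1 ^ 3) : MvPolynomial (Fin 3) ℂ) A] :
    Nonempty (A ≃ₐ[ℂ] S) := by
  let ι : MvPolynomial (Fin 4) ℂ →+* S :=
    (algebraMap _ S).comp (Ideal.Quotient.mk (Ideal.span {cusp + X 2 ^ 2 * X 3 ^ 3}))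
  let κ := algebraMap (MvPolynomial (Fin 3) ℂ) A
  have hf : ι (cusp + X 2 ^ 2 * X 3 ^ 3) = 0 := by
    simp only [ι, RingHom.comp_apply, Ideal.Quotient.mk_singleton_self, map_zero]
  obtain ⟨v, hv⟩ : ∃ v, ι (X 2 * X 3) * v = 1 := (IsLocalization.Away.algebraMap_isUnit
    (Ideal.Quotient.mk (Ideal.span {cusp + X 2 ^ 2 * X 3 ^ 3}) (X 2 * X 3))).exists_right_inv
  obtain ⟨u, hu⟩ : ∃ u, κ (X 2 * (X 0 ^ 2 + X 1 ^ 3)) * u = 1 :=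
    (IsLocalization.Away.algebraMap_isUnit _).exists_right_inv
  simp only [map_add, map_mul, map_pow] at hf hu hv
  refine nonempty_algEquiv_away_quotient (f := cusp + X 2 ^ 2 * X 3 ^ 3) (z := X 2 * X 3)
    (q := X 2 * (X 0 ^ 2 + X 1 ^ 3))
    ![κ (X 0), κ (X 1), -κ (X 2) ^ 4 * u, -(κ (X 0) ^ 2 + κ (X 1) ^ 3) ^ 3 * u ^ 2]
    ![ι (X 0), ι (X 1), ι (X 2) * ι (X 3)]
    ?_ ?_ ?_ (fun θ hθ ↦ ?_) (fun φ hφ ↦ ?_)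
  · simp only [map_add, map_mul, map_pow, aeval_X]
    change κ (X 0) ^ 2 + κ (X 1) ^ 3 +
      (-κ (X 2) ^ 4 * u) ^ 2 * (-(κ (X 0) ^ 2 + κ (X 1) ^ 3) ^ 3 * u ^ 2) ^ 3 = 0
    grind
  · simp only [map_mul, aeval_X]
    change IsUnit ((-κ (X 2) ^ 4 * u) * (-(κ (X 0) ^ 2 + κ (X 1) ^ 3) ^ 3 * u ^ 2))
    refine IsUnit.of_mul_eq_one (u * (κ (X 0) ^ 2 + κ (X 1) ^ 3)) ?_
    grind
  · simp only [map_add, map_mul, map_pow, aeval_X]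
    change IsUnit (ι (X 2) * ι (X 3) * (ι (X 0) ^ 2 + ι (X 1) ^ 3))
    refine IsUnit.of_mul_eq_one (-ι (X 2) * v ^ 4) ?_
    grind
  · change ∀ p, θ (κ p) = _ at hθ
    change ∀ i, _ = ι (X i)
    have h := congrArg θ hu
    simp [hθ] at h
    have hu' : θ u = -ι (X 2) * v ^ 4 := by grind
    simp [Fin.forall_fin_succ, hθ, hu']
    grind
  · change ∀ p, φ (ι p) = _ at hφ
    change ∀ j, _ = κ (X j)
    simp [Fin.forall_fin_succ, hφ]
    grind

end Charts

theorem factorial_fifth_power :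
    ∃ _ : IsDomain (MvPolynomial (Fin 4) ℂ ⧸ Ideal.span {cusp + X 2 ^ 5}),
      UniqueFactorizationMonoid (MvPolynomial (Fin 4) ℂ ⧸ Ideal.span {cusp + X 2 ^ 5}) := by
  have h := prime_X_sq_add_X_cube_add_rename (X 0 ^ 5 : MvPolynomial (Fin 2) ℂ)
  simp only [map_pow, rename_X] at h
  have hD := isDomain_quotient_span (f := cusp + X 2 ^ 5) h
  refine ⟨hD, ?_⟩
  have hz : Prime (Ideal.Quotient.mk (Ideal.span {cusp + X 2 ^ 5}) (X 2)) :=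
    prime_mk_X (by simp) prime_cusp
  have hA : UniqueFactorizationMonoid (Localization.Away (X 0 ^ 2 + X 1 ^ 3 : MvPolynomial (Fin 3) ℂ)) :=
    inferInstance
  obtain ⟨e⟩ := nonempty_algEquiv_fifth_power
    (S := Localization.Away (Ideal.Quotient.mk (Ideal.span {cusp + X 2 ^ 5}) (X 2)))
    (A := Localization.Away (X 0 ^ 2 + X 1 ^ 3 : MvPolynomial (Fin 3) ℂ))
  exact (UniqueFactorizationMonoid.iff_of_isLocalizationAway_of_prime hz _).2
    (e.toMulEquiv.uniqueFactorizationMonoid hA)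

theorem factorial_cube_mul :
    ∃ _ : IsDomain (MvPolynomial (Fin 4) ℂ ⧸ Ideal.span {cusp + X 2 ^ 3 * X 3}),
      UniqueFactorizationMonoid (MvPolynomial (Fin 4) ℂ ⧸ Ideal.span {cusp + X 2 ^ 3 * X 3}) := by
  have h := prime_X_sq_add_X_cube_add_rename (X 0 ^ 3 * X 1 : MvPolynomial (Fin 2) ℂ)
  simp only [map_mul, map_pow, rename_X] at h
  have hD := isDomain_quotient_span (f := cusp + X 2 ^ 3 * X 3) h
  refine ⟨hD, ?_⟩
  have hz : Prime (Ideal.Quotient.mk (Ideal.span {cusp + X 2 ^ 3 * X 3}) (X 2)) :=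
    prime_mk_X (by simp) prime_cusp
  have hA : UniqueFactorizationMonoid (Localization.Away (X 2 : MvPolynomial (Fin 3) ℂ)) :=
    inferInstance
  obtain ⟨e⟩ := nonempty_algEquiv_cube_mul
    (S := Localization.Away (Ideal.Quotient.mk (Ideal.span {cusp + X 2 ^ 3 * X 3}) (X 2)))
    (A := Localization.Away (X 2 : MvPolynomial (Fin 3) ℂ))
  exact (UniqueFactorizationMonoid.iff_of_isLocalizationAway_of_prime hz _).2
    (e.toMulEquiv.uniqueFactorizationMonoid hA)

theorem factorial_sq_mul_cube :
    ∃ _ : IsDomain (MvPolynomial (Fin 4) ℂ ⧸ Ideal.span {cusp + X 2 ^ 2 * X 3 ^ 3}),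
      UniqueFactorizationMonoid (MvPolynomial (Fin 4) ℂ ⧸ Ideal.span {cusp + X 2 ^ 2 * X 3 ^ 3}) := by
  have h := prime_X_sq_add_X_cube_add_rename (X 0 ^ 2 * X 1 ^ 3 : MvPolynomial (Fin 2) ℂ)
  simp only [map_mul, map_pow, rename_X] at h
  have hD := isDomain_quotient_span (f := cusp + X 2 ^ 2 * X 3 ^ 3) h
  refine ⟨hD, ?_⟩
  have hdvd : ¬ Ideal.Quotient.mk (Ideal.span {cusp + X 2 ^ 2 * X 3 ^ 3}) (X 3) ∣
      Ideal.Quotient.mk (Ideal.span {cusp + X 2 ^ 2 * X 3 ^ 3}) (X 2) := by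
    rw [mk_X_dvd_mk_iff (g := cusp) (by simp)]
    intro h
    simpa using map_dvd (aeval ![(0 : ℂ), 0, 1, 0]) h
  have hA : UniqueFactorizationMonoid (Localization.Away (X 2 * (X 0 ^ 2 + X 1 ^ 3) : MvPolynomial (Fin 3) ℂ)) :=
    inferInstance
  obtain ⟨e⟩ := nonempty_algEquiv_sq_mul_cube
    (S := Localization.Away (Ideal.Quotient.mk (Ideal.span {cusp + X 2 ^ 2 * X 3 ^ 3}) (X 2 * X 3)))
    (A := Localization.Away (X 2 * (X 0 ^ 2 + X 1 ^ 3) : MvPolynomial (Fin 3) ℂ))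
  have hS := e.toMulEquiv.uniqueFactorizationMonoid hA
  have hloc : IsLocalization.Away (Ideal.Quotient.mk (Ideal.span {cusp + X 2 ^ 2 * X 3 ^ 3}) (X 2) *
      Ideal.Quotient.mk (Ideal.span {cusp + X 2 ^ 2 * X 3 ^ 3}) (X 3))
      (Localization.Away (Ideal.Quotient.mk (Ideal.span {cusp + X 2 ^ 2 * X 3 ^ 3}) (X 2 * X 3))) := by
    rw [← map_mul]
    infer_instance
  exact UniqueFactorizationMonoid.of_isLocalizationAway_mul (prime_mk_X (by simp) prime_cusp)
    (prime_mk_X (by simp) prime_cusp) hdvd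
    (Localization.Away (Ideal.Quotient.mk (Ideal.span {cusp + X 2 ^ 2 * X 3 ^ 3}) (X 2 * X 3)))

theorem factorial_mul_fourth_power :
    ∃ _ : IsDomain (MvPolynomial (Fin 4) ℂ ⧸ Ideal.span {cusp + X 2 * X 3 ^ 4}),
      UniqueFactorizationMonoid (MvPolynomial (Fin 4) ℂ ⧸ Ideal.span {cusp + X 2 * X 3 ^ 4}) := by
  have h := prime_X_sq_add_X_cube_add_rename (X 0 * X 1 ^ 4 : MvPolynomial (Fin 2) ℂ)
  simp only [map_mul, map_pow, rename_X] at h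
  have hD := isDomain_quotient_span (f := cusp + X 2 * X 3 ^ 4) h
  refine ⟨hD, ?_⟩
  have hz : Prime (Ideal.Quotient.mk (Ideal.span {cusp + X 2 * X 3 ^ 4}) (X 3)) :=
    prime_mk_X (by simp) prime_cusp
  have hA : UniqueFactorizationMonoid (Localization.Away (X 2 : MvPolynomial (Fin 3) ℂ)) :=
    inferInstance
  obtain ⟨e⟩ := nonempty_algEquiv_mul_fourth_power
    (S := Localization.Away (Ideal.Quotient.mk (Ideal.span {cusp + X 2 * X 3 ^ 4}) (X 3)))
    (A := Localization.Away (X 2 : MvPolynomial (Fin 3) ℂ))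
  exact (UniqueFactorizationMonoid.iff_of_isLocalizationAway_of_prime hz _).2
    (e.toMulEquiv.uniqueFactorizationMonoid hA)

/-- The four compound du Val hypersurface singularities nos. 8, 15, 17, 18 of the
paper's classification are factorial: for each of the trinomials
`T₁² + T₂³ + T₃⁵`, `T₁² + T₂³ + T₃³T₄`, `T₁² + T₂³ + T₃²T₄³`, `T₁² + T₂³ + T₃T₄⁴`,
the quotient `ℂ[T₁,T₂,T₃,T₄]/⟨f⟩` is an integral domain which is a unique
factorization domain. -/
theorem cdv_hypersurfaces_factorial :
    ∀ f ∈ ([X 0 ^ 2 + X 1 ^ 3 + X 2 ^ 5,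
            X 0 ^ 2 + X 1 ^ 3 + X 2 ^ 3 * X 3,
            X 0 ^ 2 + X 1 ^ 3 + X 2 ^ 2 * X 3 ^ 3,
            X 0 ^ 2 + X 1 ^ 3 + X 2 * X 3 ^ 4] :
        List (MvPolynomial (Fin 4) ℂ)),
      ∃ _ : IsDomain (MvPolynomial (Fin 4) ℂ ⧸ Ideal.span {f}),
        UniqueFactorizationMonoid (MvPolynomial (Fin 4) ℂ ⧸ Ideal.span {f}) := by
  simp only [List.forall_mem_cons, List.not_mem_nil, false_imp_iff, implies_true, and_true]
  exact ⟨factorial_fifth_power, factorial_cube_mul, factorial_sq_mul_cube,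
    factorial_mul_fourth_power⟩
end
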